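/- Consider a K-class N-agent system with finite state space X and finite action space U, class sizes N_1,...,N_K, total population N_pop = Σ_k N_k, and discount factor γ ∈ [0,1). Distributions are tracked classwise: μ̄ ∈ P(X)^K and ν̄ ∈ P(U)^K, with L1 norm |μ̄ − μ̄'|₁ = Σ_k Σ_x |μ̄(x,k) − μ̄'(x,k)|. Each class k has a reward r̄_k : X × U × P(X)^K × P(U)^K → ℝ with |r̄_k| ≤ M̄_R and |r̄_k(x,u,μ̄₁,ν̄₁) − r̄_k(x,u,μ̄₂,ν̄₂)| ≤ L̄_R(|μ̄₁−μ̄₂|₁+|ν̄₁−ν̄₂|₁), and a transition kernel P̄_k : X × U × P(X)^K × P(U)^K → P(X) with L1-Lipschitz constant L̄_P in (μ̄,ν̄). Let π̄ = {(π̄_k^t)_k}_{t≥0} be a policy whose decision rules π̄_k^t : X × P(X)^K → P(U) satisfy |π̄_k^t(x,μ̄₁) − π̄_k^t(x,μ̄₂)|₁ ≤ L̄_Q|μ̄₁−μ̄₂|₁. The N-agent process starts from states x^N_0 with classwise empirical state distributions μ̄_0 (class k's component places mass 1/N_k on each class-k agent's state); at each time t, actions u^{t,N}_{j,k} are sampled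 independently from π̄_k^t(x^{t,N}_{j,k}, μ̄_t^N), and next states independently from P̄_k(x^{t,N}_{j,k}, u^{t,N}_{j,k}, μ̄_t^N, ν̄_t^N), where μ̄_t^N, ν̄_t^N are the classwise empirical state and action distributions. Define v̄^N(x^N_0, π̄) = (1/N_pop)·Σ_k Σ_{j=1}^{N_k} E[ Σ_{t=0}^∞ γ^t r̄_k(x^{t,N}_{j,k}, u^{t,N}_{j,k}, μ̄_t^N, ν̄_t^N) ]. Define the mean-field flow: ν̄^MF(μ̄,π̄_t)(u,k) = Σ_x π̄_k^t(x,μ̄)(u)·μ̄(x,k); μ̄_{t+1}(x',k) = Σ_{x,u} μ̄_t(x,k)·π̄_k^t(x,μ̄_t)(u)·P̄_k(x,u,μ̄_t,ν̄^MF(μ̄_t,π̄_t))(x'); r̄_k^MF(μ̄,π̄_t) = Σ_{x,u} μ̄(x,k)·π̄_k^t(x,μ̄)(u)·r̄_k(x,u,μ̄,ν̄^MF(μ̄,π̄_t)); v̄^MF(μ̄_0,π̄) = Σ_k θ_k·Σ_{t=0}^∞ γ^t r̄_k^MF(μ̄_t, π̄_t), where θ_k = N_k/N_pop. Set C̄_R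 = M̄_R + L̄_R, C̄_P = 2 + K·L̄_P, S̄_R = M̄_R(1+L̄_Q) + L̄_R(2+K·L̄_Q), S̄_P = (1+K·L̄_Q) + K·L̄_P(2+K·L̄_Q). If γ·S̄_P < 1, then |v̄^N(x^N_0, π̄) − v̄^MF(μ̄_0, π̄)| ≤ (C̄_R/(1−γ))·√(|X||U|)·Σ_k (1/√N_k) + C̄_P·(S̄_R/(S̄_P−1))·√(|X||U|)·(Σ_k 1/√N_k)·[1/(1−γS̄_P) − 1/(1−γ)]. -/

import Mathlib

open MeasureTheory ProbabilityTheory Finset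

/-- A probability distribution on a finite type, represented as a nonnegative
function summing to one. -/
def IsProb {A : Type*} [Fintype A] (μ : A → ℝ) : Prop :=
  (∀ a, 0 ≤ μ a) ∧ ∑ a, μ a = 1

/-- An element of `P(A)^K`: for each class `k`, the slice `μ (·, k)` is a
probability distribution on `A`. -/
def IsProbK {A : Type*} [Fintype A] {K : ℕ} (μ : A × Fin K → ℝ) : Prop :=
  ∀ k, IsProb (fun a => μ (a, k))

/-- The L1 distance between two real-valued functions on a finite type. -/
noncomputable def l1 {A : Type*} [Fintype A] (μ ν : A → ℝ) : ℝ :=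
  ∑ a, |μ a - ν a|

set_option linter.unusedSectionVars false
set_option linter.unusedVariables false
abbrev Cfg {K : ℕ} (N : Fin K → ℕ) (A : Type*) := (k : Fin K) → Fin (N k) → A

def pw {K : ℕ} {N : Fin K → ℕ} {A : Type*} (w : (k : Fin K) → Fin (N k) → A → ℝ)
    (d : Cfg N A) : ℝ := ∏ k, ∏ j, w k j (d k j)

section
variable {K : ℕ} {N : Fin K → ℕ} {A : Type*} [Fintype A] [DecidableEq A]

lemma pw_sum (w : (k : Fin K) → Fin (N k) → A → ℝ) :
    ∑ d, pw w d = ∏ k, ∏ j, ∑ a, w k j a := by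
  unfold pw
  simp_rw [Fintype.prod_sum]

lemma pw_eq_sigma (w : (k : Fin K) → Fin (N k) → A → ℝ) (d : Cfg N A) :
    pw w d = ∏ p : (k : Fin K) × Fin (N k), w p.1 p.2 (d p.1 p.2) := by
  unfold pw
  rw [Fintype.prod_sigma]

lemma pw_isProb {w : (k : Fin K) → Fin (N k) → A → ℝ} (hw : ∀ k j, IsProb (w k j)) :
    IsProb (pw w) := by
  refine ⟨fun d => Finset.prod_nonneg fun k _ => Finset.prod_nonneg fun j _ => (hw k j).1 _, ?_⟩
  rw [pw_sum]
  exact Finset.prod_eq_one fun k _ => Finset.prod_eq_one fun j _ => (hw k j).2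

lemma pw_one {w : (k : Fin K) → Fin (N k) → A → ℝ} (hw : ∀ k j, IsProb (w k j))
    (k : Fin K) (j : Fin (N k)) (f : A → ℝ) :
    ∑ d, pw w d * f (d k j) = ∑ a, w k j a * f a := by
  let p0 : (k : Fin K) × Fin (N k) := ⟨k, j⟩
  let w' : (k : Fin K) → Fin (N k) → A → ℝ := fun k' j' a =>
    w k' j' a * (if (⟨k', j'⟩ : (k : Fin K) × Fin (N k)) = p0 then f a else 1)
  have h1 : ∀ d, pw w d * f (d k j) = pw w' d := by
    intro d
    rw [pw_eq_sigma, pw_eq_sigma]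
    simp only [w']
    rw [Finset.prod_mul_distrib, Finset.prod_ite_eq' Finset.univ p0 (fun p => f (d p.1 p.2))]
    simp [p0]
  simp_rw [h1]
  rw [pw_sum, ← Fintype.prod_sigma (fun p : (k : Fin K) × Fin (N k) => ∑ a, w' p.1 p.2 a)]
  have h2 : ∀ p : (k : Fin K) × Fin (N k), ∑ a, w' p.1 p.2 a =
      if p = p0 then ∑ a, w p.1 p.2 a * f a else 1 := by
    intro p
    simp only [w']
    split_ifs
    · rfl
    · simpa using (hw p.1 p.2).2
  simp_rw [h2]
  rw [Finset.prod_ite_eq']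
  simp [p0]

lemma pw_two {w : (k : Fin K) → Fin (N k) → A → ℝ} (hw : ∀ k j, IsProb (w k j))
    (k : Fin K) (i j : Fin (N k)) (hij : i ≠ j) (f g : A → ℝ) :
    ∑ d, pw w d * (f (d k i) * g (d k j)) = (∑ a, w k i a * f a) * ∑ a, w k j a * g a := by
  let p0 : (k : Fin K) × Fin (N k) := ⟨k, i⟩
  let p1 : (k : Fin K) × Fin (N k) := ⟨k, j⟩
  have hne : p0 ≠ p1 := by
    intro h
    simp [p0, p1] at h
    exact hij h
  let w' : (k : Fin K) → Fin (N k) → A → ℝ := fun k' j' a =>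
    w k' j' a * ((if (⟨k', j'⟩ : (k : Fin K) × Fin (N k)) = p0 then f a else 1)
      * (if (⟨k', j'⟩ : (k : Fin K) × Fin (N k)) = p1 then g a else 1))
  have h1 : ∀ d, pw w d * (f (d k i) * g (d k j)) = pw w' d := by
    intro d
    rw [pw_eq_sigma, pw_eq_sigma]
    simp only [w']
    rw [Finset.prod_mul_distrib, Finset.prod_mul_distrib,
      Finset.prod_ite_eq' Finset.univ p0 (fun p => f (d p.1 p.2)),
      Finset.prod_ite_eq' Finset.univ p1 (fun p => g (d p.1 p.2))]
    simp [p0, p1]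
  simp_rw [h1]
  rw [pw_sum, ← Fintype.prod_sigma (fun p : (k : Fin K) × Fin (N k) => ∑ a, w' p.1 p.2 a)]
  have h2 : ∀ p : (k : Fin K) × Fin (N k), ∑ a, w' p.1 p.2 a =
      (if p = p0 then ∑ a, w p.1 p.2 a * f a else 1) *
      (if p = p1 then ∑ a, w p.1 p.2 a * g a else 1) := by
    intro p
    simp only [w']
    by_cases ha : p = p0
    · have hb : p ≠ p1 := fun h => hne (ha.symm.trans h)
      simp [ha, hne]
    · by_cases hb : p = p1
      · simp [hb, hne.symm]
      · simpa [ha, hb] using (hw p.1 p.2).2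
  simp_rw [h2]
  rw [Finset.prod_mul_distrib, Finset.prod_ite_eq', Finset.prod_ite_eq']
  simp [p0, p1]
end

/-- L1 concentration. -/
lemma conc {S Y : Type*} [Fintype S] [Fintype Y] {n : ℕ} (p : S → ℝ) (hp : IsProb p)
    (g : Y → Fin n → S → ℝ) (hunc : ∀ y i j, i ≠ j → ∑ s, p s * (g y i s * g y j s) = 0)
    (V : ℝ) (hV : ∑ y, ∑ j, ∑ s, p s * (g y j s) ^ 2 ≤ V) :
    ∑ s, p s * ∑ y, |∑ j, g y j s| ≤ Real.sqrt (Fintype.card Y * V) := by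
  apply Real.le_sqrt_of_sq_le
  have hvar : ∀ y, ∑ s, p s * (∑ j, g y j s) ^ 2 = ∑ j, ∑ s, p s * (g y j s) ^ 2 := by
    intro y
    have : ∀ s, p s * (∑ j, g y j s) ^ 2 = ∑ i, ∑ j, p s * (g y i s * g y j s) := by
      intro s
      rw [sq, Finset.sum_mul_sum, Finset.mul_sum]
      simp_rw [Finset.mul_sum]
    simp_rw [this]
    rw [Finset.sum_comm]
    refine Finset.sum_congr rfl fun i _ => ?_
    rw [Finset.sum_comm, Finset.sum_eq_single i]
    · simp_rw [sq]
    · intro j _ hj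
      exact hunc y i j hj.symm
    · simp
  have h1 : (∑ s, p s * ∑ y, |∑ j, g y j s|) ^ 2 ≤ ∑ s, p s * (∑ y, |∑ j, g y j s|) ^ 2 := by
    have h := (convexOn_pow (𝕜 := ℝ) 2).map_sum_le (t := Finset.univ) (w := p)
      (p := fun s => ∑ y, |∑ j, g y j s|) (fun i _ => hp.1 i) hp.2
      (fun i _ => Set.mem_Ici.2 (Finset.sum_nonneg fun y _ => abs_nonneg _))
    simpa using h
  have h2 : ∀ s, (∑ y, |∑ j, g y j s|) ^ 2 ≤ Fintype.card Y * ∑ y, (∑ j, g y j s) ^ 2 := by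
    intro s
    have := sq_sum_le_card_mul_sum_sq (s := (Finset.univ : Finset Y)) (f := fun y => |∑ j, g y j s|)
    simpa [sq_abs] using this
  calc _ ≤ _ := h1
    _ ≤ ∑ s, p s * (Fintype.card Y * ∑ y, (∑ j, g y j s) ^ 2) :=
      Finset.sum_le_sum fun s _ => mul_le_mul_of_nonneg_left (h2 s) (hp.1 s)
    _ = Fintype.card Y * ∑ y, ∑ s, p s * (∑ j, g y j s) ^ 2 := by
      rw [Finset.sum_comm, Finset.mul_sum]
      refine Finset.sum_congr rfl fun s _ => ?_
      rw [← Finset.mul_sum]; ring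
    _ ≤ _ := by
      simp_rw [hvar]
      exact mul_le_mul_of_nonneg_left hV (Nat.cast_nonneg _)

lemma isProb_le_one {A : Type*} [Fintype A] {p : A → ℝ} (hp : IsProb p) (a : A) : p a ≤ 1 := by
  rw [← hp.2]
  exact Finset.single_le_sum (fun i _ => hp.1 i) (Finset.mem_univ a)

lemma concF {K : ℕ} {N : Fin K → ℕ} {A Y : Type*} [Fintype A] [DecidableEq A] [Fintype Y]
    {w : (k : Fin K) → Fin (N k) → A → ℝ} (hw : ∀ k j, IsProb (w k j)) (k : Fin K) (hN : 0 < N k)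
    (φ : Fin (N k) → A → Y → ℝ) (hφ : ∀ j a, IsProb (φ j a)) :
    ∑ d, pw w d * ∑ y, |(∑ j, φ j (d k j) y) / N k - (∑ j, ∑ a, w k j a * φ j a y) / N k|
      ≤ Real.sqrt (Fintype.card Y) * (1 / Real.sqrt (N k)) := by
  have hn : (0 : ℝ) < N k := Nat.cast_pos.2 hN
  let m : Fin (N k) → Y → ℝ := fun j y => ∑ a, w k j a * φ j a y
  have hc : ∀ j y, ∑ a, w k j a * (φ j a y - m j y) = 0 := by
    intro j y
    simp_rw [mul_sub]
    rw [Finset.sum_sub_distrib, ← Finset.sum_mul, (hw k j).2]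
    simp [m]
  have key := conc (pw w) (pw_isProb hw)
    (fun (y : Y) (j : Fin (N k)) (d : Cfg N A) => φ j (d k j) y - m j y)
    (by
      intro y i j hij
      have := pw_two hw k i j hij (fun a => φ i a y - m i y) (fun a => φ j a y - m j y)
      rw [this, hc, zero_mul])
    (N k) (by
      have h1 : ∀ (y : Y) (j : Fin (N k)), ∑ d, pw w d * (φ j (d k j) y - m j y) ^ 2
          ≤ ∑ a, w k j a * φ j a y := by
        intro y j
        have := pw_one hw k j (fun a => (φ j a y - m j y) ^ 2)
        rw [this]
        have e : ∑ a, w k j a * (φ j a y - m j y) ^ 2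
            = ∑ a, w k j a * (φ j a y) ^ 2 - (m j y) ^ 2 := by
          have : ∀ a, w k j a * (φ j a y - m j y) ^ 2 = w k j a * (φ j a y) ^ 2
            - 2 * m j y * (w k j a * φ j a y) + m j y ^ 2 * w k j a := fun a => by ring
          simp_rw [this]
          rw [Finset.sum_add_distrib, Finset.sum_sub_distrib, ← Finset.mul_sum, ← Finset.mul_sum,
            (hw k j).2]
          simp only [m]; ring
        rw [e]
        have : ∑ a, w k j a * (φ j a y) ^ 2 ≤ ∑ a, w k j a * φ j a y := by
          refine Finset.sum_le_sum fun a _ => mul_le_mul_of_nonneg_left ?_ ((hw k j).1 a)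
          have h0 := (hφ j a).1 y
          have h1 := isProb_le_one (hφ j a) y
          nlinarith
        nlinarith [sq_nonneg (m j y)]
      calc _ ≤ ∑ y, ∑ j, ∑ a, w k j a * φ j a y :=
            Finset.sum_le_sum fun y _ => Finset.sum_le_sum fun j _ => h1 y j
        _ = ∑ j, ∑ a, w k j a * ∑ y, φ j a y := by
            rw [Finset.sum_comm]
            refine Finset.sum_congr rfl fun j _ => ?_
            rw [Finset.sum_comm]
            simp_rw [Finset.mul_sum]
        _ = N k := by simp [(hφ _ _).2, (hw _ _).2]
        _ ≤ N k := le_rfl)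
  have e : ∀ d : Cfg N A, ∑ y, |(∑ j, φ j (d k j) y) / N k - (∑ j, ∑ a, w k j a * φ j a y) / N k|
      = (∑ y, |∑ j, (φ j (d k j) y - m j y)|) / N k := by
    intro d
    rw [Finset.sum_div]
    refine Finset.sum_congr rfl fun y _ => ?_
    rw [← sub_div, abs_div, abs_of_pos hn, Finset.sum_sub_distrib]
  simp_rw [e, ← mul_div_assoc]
  rw [← Finset.sum_div, div_le_iff₀ hn]
  refine key.trans (le_of_eq ?_)
  rw [Real.sqrt_mul (Nat.cast_nonneg _)]
  have h0 : Real.sqrt (N k) ≠ 0 := (Real.sqrt_pos.2 hn).ne'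
  have h1 := Real.mul_self_sqrt hn.le
  field_simp
  rw [sq, h1]

noncomputable def emp {K : ℕ} (N : Fin K → ℕ) {A : Type*} [DecidableEq A] (c : Cfg N A) :
    A × Fin K → ℝ := fun p => (∑ j, if c p.2 j = p.1 then (1 : ℝ) else 0) / (N p.2 : ℝ)

lemma sum_emp {K : ℕ} {N : Fin K → ℕ} {A : Type*} [Fintype A] [DecidableEq A] (c : Cfg N A)
    (k : Fin K) (h : A → ℝ) : ∑ x, emp N c (x, k) * h x = (∑ j, h (c k j)) / N k := by
  simp only [emp, div_mul_eq_mul_div, ← Finset.sum_div, Finset.sum_mul]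
  congr 1
  exact (Finset.sum_comm (s := Finset.univ) (t := (Finset.univ : Finset (Fin (N k))))
    (f := fun x j => (if c k j = x then (1 : ℝ) else 0) * h x)).trans (by simp)

lemma emp_isProbK {K : ℕ} {N : Fin K → ℕ} (hN : ∀ k, 0 < N k) {A : Type*} [Fintype A]
    [DecidableEq A] (c : Cfg N A) : IsProbK (emp N c) := by
  intro k
  constructor
  · intro a
    simp only [emp]
    positivity
  · have := sum_emp c k (fun _ => 1)
    simp only [mul_one] at this
    rw [this]
    have : (N k : ℝ) ≠ 0 := Nat.cast_ne_zero.2 (hN k).ne'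
    simp [this]

lemma l1_nonneg {A : Type*} [Fintype A] (μ ν : A → ℝ) : 0 ≤ l1 μ ν :=
  Finset.sum_nonneg fun _ _ => abs_nonneg _

lemma l1_tri {A : Type*} [Fintype A] (μ ν ρ : A → ℝ) : l1 μ ρ ≤ l1 μ ν + l1 ν ρ := by
  unfold l1
  rw [← Finset.sum_add_distrib]
  exact Finset.sum_le_sum fun a _ => abs_sub_le _ _ _

lemma l1_prodK {A : Type*} [Fintype A] {K : ℕ} (μ ν : A × Fin K → ℝ) :
    l1 μ ν = ∑ k, l1 (fun a => μ (a, k)) (fun a => ν (a, k)) := by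
  unfold l1
  rw [Fintype.sum_prod_type_right]

lemma l1_slice_le {A : Type*} [Fintype A] {K : ℕ} (μ ν : A × Fin K → ℝ) (k : Fin K) :
    l1 (fun a => μ (a, k)) (fun a => ν (a, k)) ≤ l1 μ ν := by
  rw [l1_prodK]
  exact Finset.single_le_sum (f := fun k => l1 (fun a => μ (a, k)) (fun a => ν (a, k)))
    (fun k _ => l1_nonneg _ _) (Finset.mem_univ k)

lemma jmix {A B : Type*} [Fintype A] [Fintype B] {p1 p2 : A → ℝ} {q1 q2 : A → B → ℝ} {δ : ℝ}
    (hp2 : IsProb p2) (hq1 : ∀ a, IsProb (q1 a)) (hδ : ∀ a, l1 (q1 a) (q2 a) ≤ δ) :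
    l1 (fun z : A × B => p1 z.1 * q1 z.1 z.2) (fun z => p2 z.1 * q2 z.1 z.2) ≤ l1 p1 p2 + δ := by
  unfold l1 at *
  rw [Fintype.sum_prod_type]
  calc _ ≤ ∑ a, ∑ b, (|p1 a - p2 a| * q1 a b + p2 a * |q1 a b - q2 a b|) := by
        refine Finset.sum_le_sum fun a _ => Finset.sum_le_sum fun b _ => ?_
        have : p1 a * q1 a b - p2 a * q2 a b
          = (p1 a - p2 a) * q1 a b + p2 a * (q1 a b - q2 a b) := by ring
        simp only [this]
        refine (abs_add_le _ _).trans (le_of_eq ?_)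
        rw [abs_mul, abs_mul, abs_of_nonneg ((hq1 a).1 b), abs_of_nonneg (hp2.1 a)]
    _ = ∑ a, (|p1 a - p2 a| + p2 a * ∑ b, |q1 a b - q2 a b|) := by
        refine Finset.sum_congr rfl fun a _ => ?_
        rw [Finset.sum_add_distrib, ← Finset.mul_sum, ← Finset.mul_sum, (hq1 a).2, mul_one]
    _ ≤ ∑ a, (|p1 a - p2 a| + p2 a * δ) := by
        refine Finset.sum_le_sum fun a _ => ?_
        have := mul_le_mul_of_nonneg_left (hδ a) (hp2.1 a)
        linarith
    _ = _ := by rw [Finset.sum_add_distrib, ← Finset.sum_mul, hp2.2, one_mul]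

lemma mix {A B : Type*} [Fintype A] [Fintype B] {p1 p2 : A → ℝ} {q1 q2 : A → B → ℝ} {δ : ℝ}
    (hp2 : IsProb p2) (hq1 : ∀ a, IsProb (q1 a)) (hδ : ∀ a, l1 (q1 a) (q2 a) ≤ δ) :
    l1 (fun b => ∑ a, p1 a * q1 a b) (fun b => ∑ a, p2 a * q2 a b) ≤ l1 p1 p2 + δ := by
  refine le_trans ?_ (jmix (p1 := p1) hp2 hq1 hδ)
  unfold l1
  rw [Fintype.sum_prod_type_right]
  refine Finset.sum_le_sum fun b _ => ?_
  rw [← Finset.sum_sub_distrib]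
  exact Finset.abs_sum_le_sum_abs _ _

lemma rmix {A : Type*} [Fintype A] {p1 p2 : A → ℝ} {f1 f2 : A → ℝ} {M δ : ℝ}
    (hp2 : IsProb p2) (hf : ∀ a, |f1 a| ≤ M) (hδ : ∀ a, |f1 a - f2 a| ≤ δ) :
    |∑ a, p1 a * f1 a - ∑ a, p2 a * f2 a| ≤ M * l1 p1 p2 + δ := by
  rw [← Finset.sum_sub_distrib]
  calc _ ≤ ∑ a, |p1 a * f1 a - p2 a * f2 a| := Finset.abs_sum_le_sum_abs _ _
    _ ≤ ∑ a, (M * |p1 a - p2 a| + p2 a * δ) := by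
        refine Finset.sum_le_sum fun a _ => ?_
        have : p1 a * f1 a - p2 a * f2 a
          = f1 a * (p1 a - p2 a) + p2 a * (f1 a - f2 a) := by ring
        rw [this]
        refine (abs_add_le _ _).trans ?_
        rw [abs_mul, abs_mul, abs_of_nonneg (hp2.1 a)]
        exact add_le_add (mul_le_mul_of_nonneg_right (hf a) (abs_nonneg _))
          (mul_le_mul_of_nonneg_left (hδ a) (hp2.1 a))
    _ = _ := by
        rw [Finset.sum_add_distrib, ← Finset.sum_mul, hp2.2, one_mul, ← Finset.mul_sum]; rfl

lemma jprob {A B : Type*} [Fintype A] [Fintype B] {p : A → ℝ} {q : A → B → ℝ}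
    (hp : IsProb p) (hq : ∀ a, IsProb (q a)) : IsProb (fun z : A × B => p z.1 * q z.1 z.2) := by
  refine ⟨fun z => mul_nonneg (hp.1 _) ((hq _).1 _), ?_⟩
  rw [Fintype.sum_prod_type]
  simp_rw [← Finset.mul_sum, (hq _).2, mul_one, hp.2]

lemma mprob {A B : Type*} [Fintype A] [Fintype B] {p : A → ℝ} {q : A → B → ℝ}
    (hp : IsProb p) (hq : ∀ a, IsProb (q a)) : IsProb (fun b => ∑ a, p a * q a b) := by
  refine ⟨fun b => Finset.sum_nonneg fun a _ => mul_nonneg (hp.1 _) ((hq _).1 _), ?_⟩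
  rw [Finset.sum_comm]
  simp_rw [← Finset.mul_sum, (hq _).2, mul_one, hp.2]

/-- Bundled model, for the proof only. -/
structure Mdl (X U : Type*) [Fintype X] [Fintype U] (K : ℕ) where
  MR : ℝ
  LR : ℝ
  LP : ℝ
  LQ : ℝ
  hMR : 0 ≤ MR
  hLR : 0 ≤ LR
  hLP : 0 ≤ LP
  hLQ : 0 ≤ LQ
  r : Fin K → X → U → (X × Fin K → ℝ) → (U × Fin K → ℝ) → ℝ
  hrBdd : ∀ k x u μ ν, IsProbK μ → IsProbK ν → |r k x u μ ν| ≤ MR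
  hrLip : ∀ k x u μ₁ ν₁ μ₂ ν₂, IsProbK μ₁ → IsProbK ν₁ → IsProbK μ₂ → IsProbK ν₂ →
      |r k x u μ₁ ν₁ - r k x u μ₂ ν₂| ≤ LR * (l1 μ₁ μ₂ + l1 ν₁ ν₂)
  Pk : Fin K → X → U → (X × Fin K → ℝ) → (U × Fin K → ℝ) → X → ℝ
  hPkProb : ∀ k x u μ ν, IsProbK μ → IsProbK ν → IsProb (Pk k x u μ ν)
  hPkLip : ∀ k x u μ₁ ν₁ μ₂ ν₂, IsProbK μ₁ → IsProbK ν₁ → IsProbK μ₂ → IsProbK ν₂ →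
      l1 (Pk k x u μ₁ ν₁) (Pk k x u μ₂ ν₂) ≤ LP * (l1 μ₁ μ₂ + l1 ν₁ ν₂)
  pi : ℕ → Fin K → X → (X × Fin K → ℝ) → U → ℝ
  hpiProb : ∀ t k x μ, IsProbK μ → IsProb (pi t k x μ)
  hpiLip : ∀ t k x μ₁ μ₂, IsProbK μ₁ → IsProbK μ₂ →
      l1 (pi t k x μ₁) (pi t k x μ₂) ≤ LQ * l1 μ₁ μ₂

namespace Mdl
variable {X U : Type*} [Fintype X] [Fintype U] {K : ℕ} (m : Mdl X U K)

noncomputable def nu (t : ℕ) (μ : X × Fin K → ℝ) : U × Fin K → ℝ :=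
  fun p => ∑ x, μ (x, p.2) * m.pi t p.2 x μ p.1

/-- joint state-action law in class k -/
noncomputable def jt (t : ℕ) (μ : X × Fin K → ℝ) (k : Fin K) : X × U → ℝ :=
  fun z => μ (z.1, k) * m.pi t k z.1 μ z.2

noncomputable def nxt (t : ℕ) (μ : X × Fin K → ℝ) : X × Fin K → ℝ :=
  fun p => ∑ z : X × U, m.jt t μ p.2 z * m.Pk p.2 z.1 z.2 μ (m.nu t μ) p.1

noncomputable def rw' (t : ℕ) (μ : X × Fin K → ℝ) (k : Fin K) : ℝ :=
  ∑ z : X × U, m.jt t μ k z * m.r k z.1 z.2 μ (m.nu t μ)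

noncomputable def SP : ℝ := (1 + (K : ℝ) * m.LQ) + (K : ℝ) * m.LP * (2 + (K : ℝ) * m.LQ)
noncomputable def SR : ℝ := m.MR * (1 + m.LQ) + m.LR * (2 + (K : ℝ) * m.LQ)
noncomputable def CP : ℝ := 2 + (K : ℝ) * m.LP
noncomputable def CR : ℝ := m.MR + m.LR

variable {m}
lemma nu_prob {t : ℕ} {μ : X × Fin K → ℝ} (h : IsProbK μ) : IsProbK (m.nu t μ) :=
  fun k => mprob (h k) (fun x => m.hpiProb t k x μ h)

lemma jt_prob {t : ℕ} {μ : X × Fin K → ℝ} (h : IsProbK μ) (k : Fin K) : IsProb (m.jt t μ k) :=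
  jprob (h k) (fun x => m.hpiProb t k x μ h)

lemma nxt_prob {t : ℕ} {μ : X × Fin K → ℝ} (h : IsProbK μ) : IsProbK (m.nxt t μ) :=
  fun k => mprob (jt_prob h k) (fun z => m.hPkProb k z.1 z.2 μ _ h (nu_prob h))

lemma jt_lip {t : ℕ} {μ μ' : X × Fin K → ℝ} (h : IsProbK μ) (h' : IsProbK μ') (k : Fin K) :
    l1 (m.jt t μ k) (m.jt t μ' k)
      ≤ l1 (fun a => μ (a, k)) (fun a => μ' (a, k)) + m.LQ * l1 μ μ' :=
  jmix (p1 := fun a => μ (a, k)) (h' k) (fun x => m.hpiProb t k x μ h) (fun x => m.hpiLip t k x μ μ' h h')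

lemma nu_lip {t : ℕ} {μ μ' : X × Fin K → ℝ} (h : IsProbK μ) (h' : IsProbK μ') :
    l1 (m.nu t μ) (m.nu t μ') ≤ (1 + K * m.LQ) * l1 μ μ' := by
  rw [l1_prodK]
  calc _ ≤ ∑ k : Fin K, (l1 (fun a => μ (a, k)) (fun a => μ' (a, k)) + m.LQ * l1 μ μ') :=
        Finset.sum_le_sum fun k _ =>
          mix (p1 := fun a => μ (a, k)) (h' k) (fun x => m.hpiProb t k x μ h) (fun x => m.hpiLip t k x μ μ' h h')
    _ = _ := by
        rw [Finset.sum_add_distrib, ← l1_prodK]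
        simp; ring

lemma nxt_lip {t : ℕ} {μ μ' : X × Fin K → ℝ} (h : IsProbK μ) (h' : IsProbK μ') :
    l1 (m.nxt t μ) (m.nxt t μ') ≤ m.SP * l1 μ μ' := by
  rw [l1_prodK]
  have hn := nu_lip (m := m) (t := t) h h'
  calc _ ≤ ∑ k : Fin K, ((l1 (fun a => μ (a, k)) (fun a => μ' (a, k)) + m.LQ * l1 μ μ')
            + m.LP * (l1 μ μ' + (1 + K * m.LQ) * l1 μ μ')) := by
        refine Finset.sum_le_sum fun k _ => ?_
        refine (mix (p1 := m.jt t μ k) (p2 := m.jt t μ' k)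
          (q1 := fun z => m.Pk k z.1 z.2 μ (m.nu t μ))
          (q2 := fun z => m.Pk k z.1 z.2 μ' (m.nu t μ')) (δ := m.LP * (l1 μ μ' + (1 + K * m.LQ) * l1 μ μ')) (jt_prob h' k)
          (fun z => m.hPkProb k z.1 z.2 μ _ h (nu_prob h)) ?_).trans ?_
        · intro z
          refine (m.hPkLip k z.1 z.2 _ _ _ _ h (nu_prob h) h' (nu_prob h')).trans ?_
          have := m.hLP
          gcongr
        · have := jt_lip (m := m) (t := t) h h' k
          linarith
    _ = _ := by
        rw [Finset.sum_add_distrib, Finset.sum_add_distrib, ← l1_prodK]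
        simp [SP]; ring

lemma rw_lip {t : ℕ} {μ μ' : X × Fin K → ℝ} (h : IsProbK μ) (h' : IsProbK μ') (k : Fin K) :
    |m.rw' t μ k - m.rw' t μ' k| ≤ m.SR * l1 μ μ' := by
  have hn := nu_lip (m := m) (t := t) h h'
  have h1 := rmix (p1 := m.jt t μ k) (p2 := m.jt t μ' k)
    (f1 := fun z => m.r k z.1 z.2 μ (m.nu t μ)) (f2 := fun z => m.r k z.1 z.2 μ' (m.nu t μ'))
    (M := m.MR) (δ := m.LR * (l1 μ μ' + (1 + K * m.LQ) * l1 μ μ')) (jt_prob h' k)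
    (fun z => m.hrBdd k z.1 z.2 _ _ h (nu_prob h)) (by
      intro z
      refine (m.hrLip k z.1 z.2 _ _ _ _ h (nu_prob h) h' (nu_prob h')).trans ?_
      have := m.hLR
      gcongr)
  refine h1.trans ?_
  have h2 := jt_lip (m := m) (t := t) h h' k
  have h3 := l1_slice_le μ μ' k
  have h4 : m.MR * l1 (m.jt t μ k) (m.jt t μ' k) ≤ m.MR * (l1 μ μ' + m.LQ * l1 μ μ') :=
    mul_le_mul_of_nonneg_left (by linarith) m.hMR
  unfold SR
  linarith

lemma rw_bdd {t : ℕ} {μ : X × Fin K → ℝ} (h : IsProbK μ) (k : Fin K) :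
    |m.rw' t μ k| ≤ m.MR := by
  unfold rw'
  refine (Finset.abs_sum_le_sum_abs _ _).trans ?_
  calc _ ≤ ∑ z, m.jt t μ k z * m.MR := by
        refine Finset.sum_le_sum fun z _ => ?_
        rw [abs_mul, abs_of_nonneg ((jt_prob h k).1 z)]
        exact mul_le_mul_of_nonneg_left (m.hrBdd _ _ _ _ _ h (nu_prob h)) ((jt_prob h k).1 z)
    _ = _ := by rw [← Finset.sum_mul, (jt_prob h k).2, one_mul]

end Mdl

lemma concE {K : ℕ} {N : Fin K → ℕ} {A : Type*} [Fintype A] [DecidableEq A]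
    {w : (k : Fin K) → Fin (N k) → A → ℝ} (hw : ∀ k j, IsProb (w k j)) (hN : ∀ k, 0 < N k) :
    ∑ d, pw w d * l1 (emp N d) (fun p => (∑ j, w p.2 j p.1) / N p.2)
      ≤ Real.sqrt (Fintype.card A) * ∑ k, 1 / Real.sqrt (N k) := by
  simp_rw [l1_prodK, Finset.mul_sum]
  rw [Finset.sum_comm]
  refine Finset.sum_le_sum fun k _ => ?_
  have h := concF hw k (hN k) (fun (_ : Fin (N k)) a y => if a = y then (1 : ℝ) else 0) (by
    intro j a
    refine ⟨fun y => by positivity, by simp⟩)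
  refine le_trans (le_of_eq ?_) h
  refine Finset.sum_congr rfl fun d _ => ?_
  simp [l1, emp]

namespace Mdl
variable {X U : Type*} [Fintype X] [Fintype U] {K : ℕ} (m : Mdl X U K)
variable [DecidableEq X] [DecidableEq U] {N : Fin K → ℕ}

noncomputable def wU (t : ℕ) (c : Cfg N X) : Cfg N U → ℝ :=
  pw (fun k j => m.pi t k (c k j) (emp N c))

noncomputable def wX (c : Cfg N X) (d : Cfg N U) : Cfg N X → ℝ :=
  pw (fun k j => m.Pk k (c k j) (d k j) (emp N c) (emp N d))

variable {m}
lemma wU_prob (hN : ∀ k, 0 < N k) (t : ℕ) (c : Cfg N X) : IsProb (m.wU t c) :=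
  pw_isProb fun k j => m.hpiProb t k _ _ (emp_isProbK hN c)

lemma wX_prob (hN : ∀ k, 0 < N k) (c : Cfg N X) (d : Cfg N U) : IsProb (m.wX c d) :=
  pw_isProb fun k j => m.hPkProb k _ _ _ _ (emp_isProbK hN c) (emp_isProbK hN d)

lemma sum_jt (t : ℕ) (c : Cfg N X) (k : Fin K) (f : X × U → ℝ) :
    ∑ z, m.jt t (emp N c) k z * f z
      = (∑ j, ∑ u, m.pi t k (c k j) (emp N c) u * f (c k j, u)) / N k := by
  rw [← sum_emp c k (fun x => ∑ u, m.pi t k x (emp N c) u * f (x, u)), Fintype.sum_prod_type]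
  refine Finset.sum_congr rfl fun x _ => ?_
  rw [Finset.mul_sum]
  refine Finset.sum_congr rfl fun u _ => ?_
  simp only [jt]; ring

lemma stepA (hN : ∀ k, 0 < N k) (t : ℕ) (c : Cfg N X) :
    ∑ d, m.wU t c d * l1 (emp N d) (m.nu t (emp N c))
      ≤ Real.sqrt (Fintype.card U) * ∑ k, 1 / Real.sqrt (N k) := by
  have h := concE (w := fun k j => m.pi t k (c k j) (emp N c))
    (fun k j => m.hpiProb t k _ _ (emp_isProbK hN c)) hN
  refine le_trans (le_of_eq ?_) h
  have : m.nu t (emp N c) = (fun p => (∑ j, m.pi t p.2 (c p.2 j) (emp N c) p.1) / N p.2) := by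
    funext p
    exact sum_emp c p.2 (fun x => m.pi t p.2 x (emp N c) p.1)
  rw [this]
  rfl

lemma wavg {S : Type*} [Fintype S] {w : S → ℝ} (hw : IsProb w) {f : S → ℝ} {a b : ℝ} {g : S → ℝ}
    (h : ∀ s, f s ≤ a + b * g s) : ∑ s, w s * f s ≤ a + b * ∑ s, w s * g s := by
  calc _ ≤ ∑ s, w s * (a + b * g s) :=
        Finset.sum_le_sum fun s _ => mul_le_mul_of_nonneg_left (h s) (hw.1 s)
    _ = ∑ s, (a * w s + b * (w s * g s)) := Finset.sum_congr rfl fun s _ => by ring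
    _ = _ := by rw [Finset.sum_add_distrib, ← Finset.mul_sum, ← Finset.mul_sum, hw.2, mul_one]

lemma stepB1 (hN : ∀ k, 0 < N k) (c : Cfg N X) (d : Cfg N U) :
    ∑ c', m.wX c d c' * l1 (emp N c')
        (fun p => (∑ j, m.Pk p.2 (c p.2 j) (d p.2 j) (emp N c) (emp N d) p.1) / N p.2)
      ≤ Real.sqrt (Fintype.card X) * ∑ k, 1 / Real.sqrt (N k) :=
  concE (w := fun k j => m.Pk k (c k j) (d k j) (emp N c) (emp N d))
    (fun k j => m.hPkProb k _ _ _ _ (emp_isProbK hN c) (emp_isProbK hN d)) hN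

lemma stepB2 (hN : ∀ k, 0 < N k) (t : ℕ) (c : Cfg N X) (d : Cfg N U) :
    l1 (fun p : X × Fin K => (∑ j, m.Pk p.2 (c p.2 j) (d p.2 j) (emp N c) (emp N d) p.1) / N p.2)
       (fun p => (∑ j, m.Pk p.2 (c p.2 j) (d p.2 j) (emp N c) (m.nu t (emp N c)) p.1) / N p.2)
      ≤ K * m.LP * l1 (emp N d) (m.nu t (emp N c)) := by
  have hc := emp_isProbK hN c
  rw [l1_prodK]
  calc _ ≤ ∑ k : Fin K, m.LP * l1 (emp N d) (m.nu t (emp N c)) := by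
        refine Finset.sum_le_sum fun k _ => ?_
        have hn : (0 : ℝ) < N k := Nat.cast_pos.2 (hN k)
        unfold l1
        simp_rw [← sub_div, abs_div, abs_of_pos hn]
        rw [← Finset.sum_div, div_le_iff₀ hn]
        calc _ ≤ ∑ x, ∑ j, |m.Pk k (c k j) (d k j) (emp N c) (emp N d) x
                - m.Pk k (c k j) (d k j) (emp N c) (m.nu t (emp N c)) x| := by
              refine Finset.sum_le_sum fun x _ => ?_
              rw [← Finset.sum_sub_distrib]
              exact Finset.abs_sum_le_sum_abs _ _
          _ = ∑ j, l1 (m.Pk k (c k j) (d k j) (emp N c) (emp N d))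
                (m.Pk k (c k j) (d k j) (emp N c) (m.nu t (emp N c))) := by
              rw [Finset.sum_comm]; rfl
          _ ≤ ∑ j : Fin (N k), m.LP * l1 (emp N d) (m.nu t (emp N c)) := by
              refine Finset.sum_le_sum fun j _ => ?_
              refine (m.hPkLip k (c k j) (d k j) _ _ _ _ hc (emp_isProbK hN d) hc
                (nu_prob hc)).trans (le_of_eq ?_)
              simp [l1]
          _ = _ := by simp [l1]; ring
    _ = _ := by simp; ring

lemma stepB3 (hN : ∀ k, 0 < N k) (t : ℕ) (c : Cfg N X) :
    ∑ d : Cfg N U, m.wU t c d * l1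
       (fun p => (∑ j, m.Pk p.2 (c p.2 j) (d p.2 j) (emp N c) (m.nu t (emp N c)) p.1) / N p.2)
       (m.nxt t (emp N c))
      ≤ Real.sqrt (Fintype.card X) * ∑ k, 1 / Real.sqrt (N k) := by
  have hc := emp_isProbK hN c
  simp_rw [l1_prodK, Finset.mul_sum]
  rw [Finset.sum_comm]
  refine Finset.sum_le_sum fun k _ => ?_
  have h := concF (w := fun k j => m.pi t k (c k j) (emp N c))
    (fun k j => m.hpiProb t k _ _ hc) k (hN k)
    (fun j u y => m.Pk k (c k j) u (emp N c) (m.nu t (emp N c)) y)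
    (fun j u => m.hPkProb k _ _ _ _ hc (nu_prob hc))
  refine le_trans (le_of_eq ?_) h
  refine Finset.sum_congr rfl fun d _ => ?_
  have : ∀ y, m.nxt t (emp N c) (y, k) = _ := fun y =>
    sum_jt t c k (fun z => m.Pk k z.1 z.2 (emp N c) (m.nu t (emp N c)) y)
  simp only [l1, this]
  rfl

lemma sqX_le [Nonempty U] : Real.sqrt (Fintype.card X)
    ≤ Real.sqrt ((Fintype.card X : ℝ) * Fintype.card U) := by
  apply Real.sqrt_le_sqrt
  have : (1 : ℝ) ≤ Fintype.card U := by exact_mod_cast Fintype.card_pos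
  exact le_mul_of_one_le_right (Nat.cast_nonneg _) this

lemma sqU_le [Nonempty X] : Real.sqrt (Fintype.card U)
    ≤ Real.sqrt ((Fintype.card X : ℝ) * Fintype.card U) := by
  apply Real.sqrt_le_sqrt
  have : (1 : ℝ) ≤ Fintype.card X := by exact_mod_cast Fintype.card_pos
  exact le_mul_of_one_le_left (Nat.cast_nonneg _) this

lemma stepB [Nonempty X] [Nonempty U] (hN : ∀ k, 0 < N k) (t : ℕ) (c : Cfg N X) :
    ∑ d, m.wU t c d * ∑ c', m.wX c d c' * l1 (emp N c') (m.nxt t (emp N c))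
      ≤ m.CP * Real.sqrt ((Fintype.card X : ℝ) * Fintype.card U)
        * ∑ k, 1 / Real.sqrt (N k) := by
  set B := ∑ k, 1 / Real.sqrt (N k) with hB
  have hB0 : 0 ≤ B := Finset.sum_nonneg fun k _ => by positivity
  set G := Real.sqrt ((Fintype.card X : ℝ) * Fintype.card U)
  have hX : Real.sqrt (Fintype.card X) * B ≤ G * B := mul_le_mul_of_nonneg_right sqX_le hB0
  have hU : Real.sqrt (Fintype.card U) * B ≤ G * B := mul_le_mul_of_nonneg_right sqU_le hB0
  have hA := stepA (m := m) hN t c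
  have h3 := stepB3 (m := m) hN t c
  have hin : ∀ d, ∑ c', m.wX c d c' * l1 (emp N c') (m.nxt t (emp N c))
      ≤ G * B + 1 * (K * m.LP * l1 (emp N d) (m.nu t (emp N c)) + l1
       (fun p => (∑ j, m.Pk p.2 (c p.2 j) (d p.2 j) (emp N c) (m.nu t (emp N c)) p.1) / N p.2)
       (m.nxt t (emp N c))) := by
    intro d
    have h1 := stepB1 (m := m) hN c d
    have h2 := stepB2 (m := m) hN t c d
    refine (wavg (wX_prob hN c d) (a := K * m.LP * l1 (emp N d) (m.nu t (emp N c)) + l1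
       (fun p => (∑ j, m.Pk p.2 (c p.2 j) (d p.2 j) (emp N c) (m.nu t (emp N c)) p.1) / N p.2)
       (m.nxt t (emp N c))) (b := 1) (g := fun c' => l1 (emp N c')
        (fun p => (∑ j, m.Pk p.2 (c p.2 j) (d p.2 j) (emp N c) (emp N d) p.1) / N p.2)) ?_).trans ?_
    · intro c'
      have e1 := l1_tri (emp N c')
        (fun p => (∑ j, m.Pk p.2 (c p.2 j) (d p.2 j) (emp N c) (emp N d) p.1) / N p.2)
        (m.nxt t (emp N c))
      have e2 := l1_tri
        (fun p => (∑ j, m.Pk p.2 (c p.2 j) (d p.2 j) (emp N c) (emp N d) p.1) / N p.2)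
        (fun p => (∑ j, m.Pk p.2 (c p.2 j) (d p.2 j) (emp N c) (m.nu t (emp N c)) p.1) / N p.2)
        (m.nxt t (emp N c))
      linarith
    · linarith
  refine (wavg (wU_prob hN t c) hin).trans ?_
  have e : ∀ d, m.wU t c d * (K * m.LP * l1 (emp N d) (m.nu t (emp N c)) + l1
       (fun p => (∑ j, m.Pk p.2 (c p.2 j) (d p.2 j) (emp N c) (m.nu t (emp N c)) p.1) / N p.2)
       (m.nxt t (emp N c))) = K * m.LP * (m.wU t c d * l1 (emp N d) (m.nu t (emp N c)))
        + m.wU t c d * l1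
       (fun p => (∑ j, m.Pk p.2 (c p.2 j) (d p.2 j) (emp N c) (m.nu t (emp N c)) p.1) / N p.2)
       (m.nxt t (emp N c)) := fun d => by ring
  simp_rw [e]
  rw [Finset.sum_add_distrib, ← Finset.mul_sum]
  have hk : (0 : ℝ) ≤ K * m.LP := mul_nonneg (Nat.cast_nonneg _) m.hLP
  have := mul_le_mul_of_nonneg_left (hA.trans hU) hk
  unfold CP
  nlinarith

lemma stepC (hN : ∀ k, 0 < N k) (t : ℕ) (c : Cfg N X) (k : Fin K) :
    |∑ d, m.wU t c d * ∑ j, m.r k (c k j) (d k j) (emp N c) (emp N d)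
        - N k * m.rw' t (emp N c) k|
      ≤ N k * (m.LR * (Real.sqrt (Fintype.card U) * ∑ k, 1 / Real.sqrt (N k))) := by
  have hc := emp_isProbK hN c
  have hn : (0 : ℝ) < N k := Nat.cast_pos.2 (hN k)
  have e1 : N k * m.rw' t (emp N c) k
      = ∑ d, m.wU t c d * ∑ j, m.r k (c k j) (d k j) (emp N c) (m.nu t (emp N c)) := by
    have := sum_jt (m := m) t c k (fun z => m.r k z.1 z.2 (emp N c) (m.nu t (emp N c)))
    unfold rw'
    rw [this, mul_div_cancel₀ _ hn.ne']
    simp_rw [Finset.mul_sum]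
    refine Eq.trans ?_ (Finset.sum_comm (s := (Finset.univ : Finset (Fin (N k)))) (t := Finset.univ)
      (f := fun j d => m.wU t c d * m.r k (c k j) (d k j) (emp N c) (m.nu t (emp N c))))
    refine Finset.sum_congr rfl fun j _ => ?_
    exact (pw_one (w := fun k j => m.pi t k (c k j) (emp N c))
      (fun k j => m.hpiProb t k _ _ hc) k j
      (fun u => m.r k (c k j) u (emp N c) (m.nu t (emp N c)))).symm
  rw [e1, ← Finset.sum_sub_distrib]
  refine (Finset.abs_sum_le_sum_abs _ _).trans ?_
  have e2 : ∀ d, |m.wU t c d * ∑ j, m.r k (c k j) (d k j) (emp N c) (emp N d)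
      - m.wU t c d * ∑ j, m.r k (c k j) (d k j) (emp N c) (m.nu t (emp N c))|
      = m.wU t c d * |∑ j, (m.r k (c k j) (d k j) (emp N c) (emp N d)
        - m.r k (c k j) (d k j) (emp N c) (m.nu t (emp N c)))| := by
    intro d
    rw [← mul_sub, abs_mul, abs_of_nonneg ((wU_prob hN t c).1 d), Finset.sum_sub_distrib]
  simp_rw [e2]
  refine (wavg (wU_prob hN t c) (a := 0) (b := N k * m.LR)
    (g := fun d => l1 (emp N d) (m.nu t (emp N c))) ?_).trans ?_
  · intro d
    refine (Finset.abs_sum_le_sum_abs _ _).trans ?_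
    calc _ ≤ ∑ j : Fin (N k), m.LR * l1 (emp N d) (m.nu t (emp N c)) := by
          refine Finset.sum_le_sum fun j _ => ?_
          refine (m.hrLip k (c k j) (d k j) _ _ _ _ hc (emp_isProbK hN d) hc
                (nu_prob hc)).trans (le_of_eq ?_)
          simp [l1]
      _ = _ := by simp; ring
  · rw [zero_add, mul_assoc]
    have := m.hLR
    exact mul_le_mul_of_nonneg_left (mul_le_mul_of_nonneg_left (stepA hN t c) m.hLR) hn.le

variable (m)
noncomputable def q (x0 : Cfg N X) : ℕ → Cfg N X → ℝ
  | 0 => fun c => if c = x0 then 1 else 0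
  | t + 1 => fun c' => ∑ c, q x0 t c * ∑ d, m.wU t c d * m.wX c d c'

noncomputable def mus (x0 : Cfg N X) : ℕ → X × Fin K → ℝ
  | 0 => emp N x0
  | t + 1 => m.nxt t (mus x0 t)

variable {m}
lemma q_prob (hN : ∀ k, 0 < N k) (x0 : Cfg N X) (t : ℕ) : IsProb (m.q x0 t) := by
  induction t with
  | zero => exact ⟨fun c => by simp only [q]; positivity, by simp [q]⟩
  | succ t ih =>
    exact mprob ih fun c => mprob (wU_prob hN t c) fun d => wX_prob hN c d

lemma mus_prob (hN : ∀ k, 0 < N k) (x0 : Cfg N X) (t : ℕ) : IsProbK (m.mus x0 t) := by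
  induction t with
  | zero => exact emp_isProbK hN x0
  | succ t ih => exact nxt_prob ih

lemma q_succ (x0 : Cfg N X) (t : ℕ) (F : Cfg N X → ℝ) :
    ∑ c', m.q x0 (t + 1) c' * F c'
      = ∑ c, m.q x0 t c * ∑ d, m.wU t c d * ∑ c', m.wX c d c' * F c' := by
  simp only [q, Finset.sum_mul, Finset.mul_sum]
  rw [Finset.sum_comm]
  refine Finset.sum_congr rfl fun c _ => ?_
  rw [Finset.sum_comm]
  refine Finset.sum_congr rfl fun d _ => ?_
  refine Finset.sum_congr rfl fun c' _ => ?_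
  ring

lemma Dbound [Nonempty X] [Nonempty U] (hN : ∀ k, 0 < N k) (x0 : Cfg N X) (hSP : m.SP ≠ 1)
    (t : ℕ) :
    ∑ c, m.q x0 t c * l1 (emp N c) (m.mus x0 t)
      ≤ m.CP * Real.sqrt ((Fintype.card X : ℝ) * Fintype.card U)
        * (∑ k, 1 / Real.sqrt (N k)) * ((m.SP ^ t - 1) / (m.SP - 1)) := by
  have hS0 : 0 ≤ m.SP := by
    have := m.hLP; have := m.hLQ
    unfold SP; positivity
  induction t with
  | zero => simp [q, mus, l1]
  | succ t ih =>
    rw [q_succ]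
    have h1 : ∀ c, ∑ d, m.wU t c d * ∑ c', m.wX c d c' * l1 (emp N c') (m.mus x0 (t + 1))
        ≤ m.CP * Real.sqrt ((Fintype.card X : ℝ) * Fintype.card U)
        * (∑ k, 1 / Real.sqrt (N k)) + m.SP * l1 (emp N c) (m.mus x0 t) := by
      intro c
      have hl := nxt_lip (m := m) (t := t) (emp_isProbK hN c) (mus_prob (m := m) hN x0 t)
      have : ∀ d, ∑ c', m.wX c d c' * l1 (emp N c') (m.mus x0 (t + 1))
          ≤ m.SP * l1 (emp N c) (m.mus x0 t)
            + 1 * ∑ c', m.wX c d c' * l1 (emp N c') (m.nxt t (emp N c)) := by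
        intro d
        refine wavg (wX_prob hN c d) fun c' => ?_
        have := l1_tri (emp N c') (m.nxt t (emp N c)) (m.mus x0 (t + 1))
        have e : m.mus x0 (t + 1) = m.nxt t (m.mus x0 t) := rfl
        rw [e] at this ⊢
        linarith
      have h2 := wavg (wU_prob (m := m) hN t c) this
      have h3 := stepB (m := m) hN t c
      linarith
    refine (wavg (q_prob hN x0 t) h1).trans ?_
    have h2 := mul_le_mul_of_nonneg_left ih hS0
    refine (add_le_add_right h2 _).trans (le_of_eq ?_)
    have : m.SP - 1 ≠ 0 := sub_ne_zero.2 hSP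
    field_simp
    ring

lemma main_gen [Nonempty X] [Nonempty U] (hN : ∀ k, 0 < N k) (x0 : Cfg N X) (hSP : m.SP ≠ 1)
    (t : ℕ) (k : Fin K) :
    |∑ c, m.q x0 t c * ∑ d, m.wU t c d * ∑ j, m.r k (c k j) (d k j) (emp N c) (emp N d)
        - N k * m.rw' t (m.mus x0 t) k|
      ≤ N k * (m.CR * Real.sqrt ((Fintype.card X : ℝ) * Fintype.card U)
          * (∑ k, 1 / Real.sqrt (N k))
        + m.CP * (m.SR / (m.SP - 1)) * Real.sqrt ((Fintype.card X : ℝ) * Fintype.card U)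
          * (∑ k, 1 / Real.sqrt (N k)) * (m.SP ^ t - 1)) := by
  have hD := Dbound (m := m) hN x0 hSP t
  set B := ∑ k, 1 / Real.sqrt (N k) with hB
  have hB0 : 0 ≤ B := Finset.sum_nonneg fun k _ => by positivity
  set G := Real.sqrt ((Fintype.card X : ℝ) * Fintype.card U)
  have hU : Real.sqrt (Fintype.card U) * B ≤ G * B := mul_le_mul_of_nonneg_right sqU_le hB0
  have hn : (0 : ℝ) < N k := Nat.cast_pos.2 (hN k)
  have e0 : N k * m.rw' t (m.mus x0 t) k = ∑ c, m.q x0 t c * (N k * m.rw' t (m.mus x0 t) k) := by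
    rw [← Finset.sum_mul, (q_prob hN x0 t).2, one_mul]
  rw [e0, ← Finset.sum_sub_distrib]
  refine (Finset.abs_sum_le_sum_abs _ _).trans ?_
  simp_rw [← mul_sub, abs_mul, abs_of_nonneg ((q_prob (m := m) hN x0 t).1 _)]
  refine (wavg (q_prob hN x0 t) (a := N k * (m.LR * (G * B))) (b := N k * m.SR)
    (g := fun c => l1 (emp N c) (m.mus x0 t)) ?_).trans ?_
  · intro c
    have h1 := stepC (m := m) hN t c k
    have h2 := rw_lip (m := m) (t := t) (emp_isProbK hN c) (mus_prob (m := m) hN x0 t) k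
    have h3 : |N k * m.rw' t (emp N c) k - N k * m.rw' t (m.mus x0 t) k|
        ≤ N k * (m.SR * l1 (emp N c) (m.mus x0 t)) := by
      rw [← mul_sub, abs_mul, abs_of_pos hn]
      exact mul_le_mul_of_nonneg_left h2 hn.le
    refine (abs_sub_le _ (N k * m.rw' t (emp N c) k) _).trans ?_
    have h4 : N k * (m.LR * (Real.sqrt (Fintype.card U) * B)) ≤ N k * (m.LR * (G * B)) :=
      mul_le_mul_of_nonneg_left (mul_le_mul_of_nonneg_left hU m.hLR) hn.le
    linarith
  · have hSR : 0 ≤ m.SR := by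
      have := m.hLR; have := m.hLQ; have := m.hMR
      unfold SR; positivity
    have h5 := mul_le_mul_of_nonneg_left hD (mul_nonneg hn.le hSR)
    have h6 : m.LR * (G * B) ≤ m.CR * G * B := by
      have : 0 ≤ m.MR * (G * B) := mul_nonneg m.hMR (mul_nonneg (Real.sqrt_nonneg _) hB0)
      unfold CR; linarith
    have h7 := mul_le_mul_of_nonneg_left h6 hn.le
    refine (add_le_add h7 h5).trans (le_of_eq ?_)
    ring

variable (m) in
noncomputable def ps (x0 : Cfg N X) (t : ℕ) : Cfg N X × Cfg N U → ℝ :=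
  fun s => m.q x0 t s.1 * m.wU t s.1 s.2

lemma ps_prob (hN : ∀ k, 0 < N k) (x0 : Cfg N X) (t : ℕ) : IsProb (m.ps x0 t) :=
  jprob (q_prob hN x0 t) (fun c => wU_prob hN t c)

lemma sum_ps (x0 : Cfg N X) (t : ℕ) (F : Cfg N X × Cfg N U → ℝ) :
    ∑ s, m.ps x0 t s * F s = ∑ c, m.q x0 t c * ∑ d, m.wU t c d * F (c, d) := by
  rw [Fintype.sum_prod_type]
  refine Finset.sum_congr rfl fun c _ => ?_
  rw [Finset.mul_sum]
  refine Finset.sum_congr rfl fun d _ => ?_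
  simp only [ps]; ring

lemma ps_zero (x0 : Cfg N X) (F : Cfg N X × Cfg N U → ℝ) :
    ∑ s, m.ps x0 0 s * F s = ∑ d, m.wU 0 x0 d * F (x0, d) := by
  rw [sum_ps]
  simp [q]

lemma ps_succ (x0 : Cfg N X) (t : ℕ) (F : Cfg N X × Cfg N U → ℝ) :
    ∑ s, m.ps x0 (t + 1) s * F s
      = ∑ s, m.ps x0 t s * ∑ c', m.wX s.1 s.2 c' * ∑ d', m.wU (t + 1) c' d' * F (c', d') := by
  rw [sum_ps, sum_ps, q_succ]

variable (m) in
noncomputable def hU (x0 : Cfg N X) (t : ℕ) (k : Fin K) (f : X × U → ℝ) (x : X) : ℝ :=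
  ∑ u, m.pi t k x (m.mus x0 t) u * f (x, u)

variable (m) in
noncomputable def hat (x0 : Cfg N X) (t : ℕ) (k : Fin K) (f : X × U → ℝ) (z : X × U) : ℝ :=
  ∑ x, m.Pk k z.1 z.2 (m.mus x0 t) (m.nu t (m.mus x0 t)) x * m.hU x0 (t + 1) k f x

lemma l1_eq {A : Type*} [Fintype A] {p q : A → ℝ} (h : l1 p q ≤ 0) : p = q := by
  funext a
  have h1 : |p a - q a| ≤ l1 p q :=
    Finset.single_le_sum (f := fun a => |p a - q a|) (fun _ _ => abs_nonneg _) (Finset.mem_univ a)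
  have := abs_nonpos_iff.1 (h1.trans h)
  linarith

section deg
variable (hN : ∀ k, 0 < N k) (hP : m.LP = 0) (hQ : m.LQ = 0)

include hN hQ in
lemma pi_const (x0 : Cfg N X) (t : ℕ) (k : Fin K) (x : X) (c : Cfg N X) :
    m.pi t k x (emp N c) = m.pi t k x (m.mus x0 t) := by
  apply l1_eq
  have := m.hpiLip t k x _ _ (emp_isProbK hN c) (mus_prob (m := m) hN x0 t)
  rwa [hQ, zero_mul] at this

include hN hP in
lemma Pk_const (x0 : Cfg N X) (t : ℕ) (k : Fin K) (x : X) (u : U) (c : Cfg N X) (d : Cfg N U) :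
    m.Pk k x u (emp N c) (emp N d) = m.Pk k x u (m.mus x0 t) (m.nu t (m.mus x0 t)) := by
  apply l1_eq
  have hm := mus_prob (m := m) hN x0 t
  have := m.hPkLip k x u _ _ _ _ (emp_isProbK hN c) (emp_isProbK hN d) hm (nu_prob (m := m) (t := t) hm)
  rwa [hP, zero_mul] at this

include hN hQ in
lemma wU_one (x0 : Cfg N X) (t : ℕ) (c : Cfg N X) (k : Fin K) (j : Fin (N k)) (f : X × U → ℝ) :
    ∑ d, m.wU t c d * f (c k j, d k j) = m.hU x0 t k f (c k j) := by
  have := pw_one (w := fun k j => m.pi t k (c k j) (emp N c))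
      (fun k j => m.hpiProb t k _ _ (emp_isProbK hN c)) k j (fun u => f (c k j, u))
  refine this.trans ?_
  simp only [hU, pi_const hN hQ x0]

include hN hQ in
lemma wU_two (x0 : Cfg N X) (t : ℕ) (c : Cfg N X) (k : Fin K) (i j : Fin (N k)) (hij : i ≠ j)
    (f g : X × U → ℝ) :
    ∑ d, m.wU t c d * (f (c k i, d k i) * g (c k j, d k j))
      = m.hU x0 t k f (c k i) * m.hU x0 t k g (c k j) := by
  have := pw_two (w := fun k j => m.pi t k (c k j) (emp N c))
      (fun k j => m.hpiProb t k _ _ (emp_isProbK hN c)) k i j hij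
      (fun u => f (c k i, u)) (fun u => g (c k j, u))
  refine this.trans ?_
  simp only [hU, pi_const hN hQ x0]

include hN hP hQ in
lemma Ex_one_succ (x0 : Cfg N X) (t : ℕ) (k : Fin K) (j : Fin (N k)) (f : X × U → ℝ) :
    ∑ s, m.ps x0 (t + 1) s * f (s.1 k j, s.2 k j)
      = ∑ s, m.ps x0 t s * m.hat x0 t k f (s.1 k j, s.2 k j) := by
  rw [ps_succ]
  refine Finset.sum_congr rfl fun s _ => ?_
  congr 1
  simp_rw [wU_one hN hQ x0]
  have := pw_one (w := fun k j => m.Pk k (s.1 k j) (s.2 k j) (emp N s.1) (emp N s.2))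
      (fun k j => m.hPkProb k _ _ _ _ (emp_isProbK hN s.1) (emp_isProbK hN s.2)) k j
      (fun x => m.hU x0 (t + 1) k f x)
  refine this.trans ?_
  simp only [hat, Pk_const hN hP x0 t]

include hN hP hQ in
lemma Ex_two_succ (x0 : Cfg N X) (t : ℕ) (k : Fin K) (i j : Fin (N k)) (hij : i ≠ j)
    (f g : X × U → ℝ) :
    ∑ s, m.ps x0 (t + 1) s * (f (s.1 k i, s.2 k i) * g (s.1 k j, s.2 k j))
      = ∑ s, m.ps x0 t s * (m.hat x0 t k f (s.1 k i, s.2 k i)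
          * m.hat x0 t k g (s.1 k j, s.2 k j)) := by
  rw [ps_succ]
  refine Finset.sum_congr rfl fun s _ => ?_
  congr 1
  simp_rw [wU_two hN hQ x0 _ _ _ _ _ hij]
  have := pw_two (w := fun k j => m.Pk k (s.1 k j) (s.2 k j) (emp N s.1) (emp N s.2))
      (fun k j => m.hPkProb k _ _ _ _ (emp_isProbK hN s.1) (emp_isProbK hN s.2)) k i j hij
      (fun x => m.hU x0 (t + 1) k f x) (fun x => m.hU x0 (t + 1) k g x)
  refine this.trans ?_
  simp only [hat, Pk_const hN hP x0 t]

include hN hP hQ in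
lemma Ex_two (x0 : Cfg N X) (t : ℕ) (k : Fin K) (i j : Fin (N k)) (hij : i ≠ j)
    (f g : X × U → ℝ) :
    ∑ s, m.ps x0 t s * (f (s.1 k i, s.2 k i) * g (s.1 k j, s.2 k j))
      = (∑ s, m.ps x0 t s * f (s.1 k i, s.2 k i)) * ∑ s, m.ps x0 t s * g (s.1 k j, s.2 k j) := by
  induction t generalizing f g with
  | zero =>
    rw [ps_zero, ps_zero, ps_zero]
    simp only
    rw [wU_two hN hQ x0 0 x0 k i j hij, wU_one hN hQ x0, wU_one hN hQ x0]
  | succ t ih =>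
    rw [Ex_two_succ hN hP hQ x0 t k i j hij, Ex_one_succ hN hP hQ, Ex_one_succ hN hP hQ, ih]

include hN hP hQ in
lemma Ex_mean (x0 : Cfg N X) (t : ℕ) (k : Fin K) (f : X × U → ℝ) :
    ∑ j, ∑ s, m.ps x0 t s * f (s.1 k j, s.2 k j)
      = N k * ∑ z, m.jt t (m.mus x0 t) k z * f z := by
  have hn : (N k : ℝ) ≠ 0 := Nat.cast_ne_zero.2 (hN k).ne'
  induction t generalizing f with
  | zero =>
    simp_rw [ps_zero, wU_one hN hQ x0]
    have := sum_jt (m := m) 0 x0 k f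
    have e : m.mus x0 0 = emp N x0 := rfl
    rw [e, this, mul_div_cancel₀ _ hn]
    simp only [hU, e]
  | succ t ih =>
    simp_rw [Ex_one_succ hN hP hQ]
    rw [ih]
    congr 1
    have e : ∀ z, m.jt (t + 1) (m.mus x0 (t + 1)) k z * f z
      = m.nxt t (m.mus x0 t) (z.1, k) * (m.pi (t + 1) k z.1 (m.mus x0 (t + 1)) z.2 * f z) := by
      intro z
      simp only [jt]
      rw [mul_assoc]; rfl
    simp_rw [e]
    rw [Fintype.sum_prod_type (f := fun z : X × U => m.nxt t (m.mus x0 t) (z.1, k) *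
      (m.pi (t + 1) k z.1 (m.mus x0 (t + 1)) z.2 * f z))]
    simp_rw [← Finset.mul_sum]
    simp only [hat, Finset.mul_sum, nxt, Finset.sum_mul, hU]
    rw [Finset.sum_comm]
    refine Finset.sum_congr rfl fun x _ => ?_
    rw [Finset.sum_comm]
    refine Finset.sum_congr rfl fun u _ => ?_
    refine Finset.sum_congr rfl fun z _ => ?_
    ring

include hN hP hQ in
lemma degC {Y : Type*} [Fintype Y] [DecidableEq Y] [Nonempty Y] (proj : X × U → Y)
    (x0 : Cfg N X) (t : ℕ) (k : Fin K) :
    ∑ s, m.ps x0 t s * ∑ y, |(∑ j, if proj (s.1 k j, s.2 k j) = y then (1 : ℝ) else 0) / N k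
        - ∑ z, m.jt t (m.mus x0 t) k z * (if proj z = y then 1 else 0)|
      ≤ Real.sqrt (Fintype.card Y - 1) * (1 / Real.sqrt (N k)) := by
  have hn : (0 : ℝ) < N k := Nat.cast_pos.2 (hN k)
  have hY : (0 : ℝ) < Fintype.card Y := Nat.cast_pos.2 Fintype.card_pos
  have hp := ps_prob (m := m) hN x0 t
  let I : Y → X × U → ℝ := fun y z => if proj z = y then 1 else 0
  let a : Fin (N k) → Y → ℝ := fun j y => ∑ s, m.ps x0 t s * I y (s.1 k j, s.2 k j)
  have ha1 : ∀ j, ∑ y, a j y = 1 := by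
    intro j
    simp only [a]
    rw [Finset.sum_comm]
    simp [I, hp.2]
  have hc : ∀ j y, ∑ s, m.ps x0 t s * (I y (s.1 k j, s.2 k j) - a j y) = 0 := by
    intro j y
    simp_rw [mul_sub]
    rw [Finset.sum_sub_distrib, ← Finset.sum_mul, hp.2, one_mul]
    simp [a]
  have key := conc (m.ps x0 t) hp
    (fun (y : Y) (j : Fin (N k)) s => I y (s.1 k j, s.2 k j) - a j y)
    (by
      intro y i j hij
      have := Ex_two hN hP hQ x0 t k i j hij (fun z => I y z - a i y) (fun z => I y z - a j y)
      rw [this, hc, zero_mul])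
    (N k * (1 - 1 / Fintype.card Y)) (by
      have h1 : ∀ (y : Y) (j : Fin (N k)), ∑ s, m.ps x0 t s * (I y (s.1 k j, s.2 k j) - a j y) ^ 2
          = a j y - a j y ^ 2 := by
        intro y j
        have : ∀ s : Cfg N X × Cfg N U, m.ps x0 t s * (I y (s.1 k j, s.2 k j) - a j y) ^ 2 =
            (1 - 2 * a j y) * (m.ps x0 t s * I y (s.1 k j, s.2 k j))
              + a j y ^ 2 * m.ps x0 t s := by
          intro s
          have : I y (s.1 k j, s.2 k j) ^ 2 = I y (s.1 k j, s.2 k j) := by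
            simp only [I]; split_ifs <;> norm_num
          linear_combination m.ps x0 t s * this
        simp_rw [this]
        rw [Finset.sum_add_distrib, ← Finset.mul_sum, ← Finset.mul_sum, hp.2]
        simp only [a]; ring
      simp_rw [h1]
      rw [Finset.sum_comm]
      calc _ ≤ ∑ j : Fin (N k), (1 - 1 / (Fintype.card Y : ℝ)) := by
            refine Finset.sum_le_sum fun j _ => ?_
            rw [Finset.sum_sub_distrib, ha1]
            have := sq_sum_le_card_mul_sum_sq (s := (Finset.univ : Finset Y)) (f := fun y => a j y)
            rw [ha1] at this
            have : 1 / (Fintype.card Y : ℝ) ≤ ∑ y, a j y ^ 2 := by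
              rw [div_le_iff₀ hY]
              simpa [mul_comm] using this
            linarith
        _ = _ := by simp; ring
        _ ≤ _ := le_rfl)
  have e : ∀ s : Cfg N X × Cfg N U, ∑ y, |(∑ j, if proj (s.1 k j, s.2 k j) = y then (1 : ℝ) else 0)
        / N k - ∑ z, m.jt t (m.mus x0 t) k z * (if proj z = y then 1 else 0)|
      = (∑ y, |∑ j, (I y (s.1 k j, s.2 k j) - a j y)|) / N k := by
    intro d
    rw [Finset.sum_div]
    refine Finset.sum_congr rfl fun y _ => ?_
    have := Ex_mean hN hP hQ x0 t k (I y)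
    have h2 : ∑ z, m.jt t (m.mus x0 t) k z * (if proj z = y then 1 else 0) = (∑ j, a j y) / N k := by
      rw [eq_div_iff hn.ne', mul_comm]
      exact this.symm
    rw [h2, ← sub_div, abs_div, abs_of_pos hn, Finset.sum_sub_distrib]
  simp_rw [e, ← mul_div_assoc]
  rw [← Finset.sum_div, div_le_iff₀ hn]
  refine key.trans (le_of_eq ?_)
  have h3 : (Fintype.card Y : ℝ) * (N k * (1 - 1 / Fintype.card Y)) = N k * (Fintype.card Y - 1) := by
    field_simp
  rw [h3, Real.sqrt_mul hn.le]
  have h0 : Real.sqrt (N k) ≠ 0 := (Real.sqrt_pos.2 hn).ne'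
  have h1 := Real.mul_self_sqrt hn.le
  field_simp
  rw [sq, h1]; ring

lemma sqrt_key (a b : ℝ) (ha : 1 ≤ a) (hb : 1 ≤ b) :
    Real.sqrt (a - 1) + Real.sqrt (b - 1) ≤ Real.sqrt (a * b) := by
  apply Real.le_sqrt_of_sq_le
  have h1 := Real.sq_sqrt (sub_nonneg.2 ha)
  have h2 := Real.sq_sqrt (sub_nonneg.2 hb)
  set x := Real.sqrt (a - 1)
  set y := Real.sqrt (b - 1)
  have e1 : a = x ^ 2 + 1 := by linarith
  have e2 : b = y ^ 2 + 1 := by linarith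
  have e3 : a * b = (x ^ 2 + 1) * (y ^ 2 + 1) := by rw [← e1, ← e2]
  rw [e3]
  nlinarith [sq_nonneg (x * y - 1)]

include hN hP hQ in
lemma main_deg [Nonempty X] [Nonempty U] (x0 : Cfg N X) (t : ℕ) (k : Fin K) :
    |∑ c, m.q x0 t c * ∑ d, m.wU t c d * ∑ j, m.r k (c k j) (d k j) (emp N c) (emp N d)
        - N k * m.rw' t (m.mus x0 t) k|
      ≤ N k * (m.CR * Real.sqrt ((Fintype.card X : ℝ) * Fintype.card U)
          * (∑ k, 1 / Real.sqrt (N k))) := by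
  have hn : (0 : ℝ) < N k := Nat.cast_pos.2 (hN k)
  have hm := mus_prob (m := m) hN x0 t
  have hp := ps_prob (m := m) hN x0 t
  set B := ∑ k, 1 / Real.sqrt (N k) with hB
  have hB0 : 0 ≤ B := Finset.sum_nonneg fun k _ => by positivity
  set G := Real.sqrt ((Fintype.card X : ℝ) * Fintype.card U) with hG
  have hx : ∑ s, m.ps x0 t s * l1 (emp N s.1) (m.mus x0 t)
      ≤ Real.sqrt (Fintype.card X - 1) * B := by
    simp_rw [l1_prodK, hB, Finset.mul_sum]
    rw [Finset.sum_comm]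
    refine Finset.sum_le_sum fun k _ => ?_
    refine le_trans (le_of_eq ?_) (degC hN hP hQ Prod.fst x0 t k)
    refine Finset.sum_congr rfl fun s _ => ?_
    congr 1
    unfold l1
    refine Finset.sum_congr rfl fun y _ => ?_
    have : ∑ z, m.jt t (m.mus x0 t) k z * (if z.1 = y then 1 else 0) = m.mus x0 t (y, k) := by
      rw [Fintype.sum_prod_type]
      simp [jt, ← Finset.mul_sum, (m.hpiProb t k y _ hm).2]
    rw [this]
    rfl
  have hu : ∑ s, m.ps x0 t s * l1 (emp N s.2) (m.nu t (m.mus x0 t))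
      ≤ Real.sqrt (Fintype.card U - 1) * B := by
    simp_rw [l1_prodK, hB, Finset.mul_sum]
    rw [Finset.sum_comm]
    refine Finset.sum_le_sum fun k _ => ?_
    refine le_trans (le_of_eq ?_) (degC hN hP hQ Prod.snd x0 t k)
    refine Finset.sum_congr rfl fun s _ => ?_
    congr 1
    unfold l1
    refine Finset.sum_congr rfl fun y _ => ?_
    have : ∑ z, m.jt t (m.mus x0 t) k z * (if z.2 = y then 1 else 0)
        = m.nu t (m.mus x0 t) (y, k) := by
      rw [Fintype.sum_prod_type]
      simp [jt, nu]
    rw [this]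
    rfl
  have e1 : N k * m.rw' t (m.mus x0 t) k = ∑ s : Cfg N X × Cfg N U, m.ps x0 t s *
      ∑ j, m.r k (s.1 k j) (s.2 k j) (m.mus x0 t) (m.nu t (m.mus x0 t)) := by
    have := Ex_mean hN hP hQ x0 t k
      (fun z => m.r k z.1 z.2 (m.mus x0 t) (m.nu t (m.mus x0 t)))
    unfold rw'
    rw [← this]
    simp_rw [Finset.mul_sum]
    exact Finset.sum_comm (s := (Finset.univ : Finset (Fin (N k)))) (t := Finset.univ)
      (f := fun j (s : Cfg N X × Cfg N U) => m.ps x0 t s *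
        m.r k (s.1 k j) (s.2 k j) (m.mus x0 t) (m.nu t (m.mus x0 t)))
  have e2 := sum_ps (m := m) x0 t
    (fun s => ∑ j, m.r k (s.1 k j) (s.2 k j) (emp N s.1) (emp N s.2))
  simp only at e2
  rw [← e2, e1, ← Finset.sum_sub_distrib]
  refine (Finset.abs_sum_le_sum_abs _ _).trans ?_
  simp_rw [← mul_sub, abs_mul, abs_of_nonneg (hp.1 _)]
  refine (wavg hp (a := 0) (b := N k * m.LR)
    (g := fun s => l1 (emp N s.1) (m.mus x0 t) + l1 (emp N s.2) (m.nu t (m.mus x0 t))) ?_).trans ?_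
  · intro s
    rw [← Finset.sum_sub_distrib]
    refine (Finset.abs_sum_le_sum_abs _ _).trans ?_
    calc _ ≤ ∑ j : Fin (N k), m.LR * (l1 (emp N s.1) (m.mus x0 t)
              + l1 (emp N s.2) (m.nu t (m.mus x0 t))) := by
          refine Finset.sum_le_sum fun j _ => ?_
          exact m.hrLip k _ _ _ _ _ _ (emp_isProbK hN s.1) (emp_isProbK hN s.2) hm (nu_prob hm)
      _ = _ := by simp; ring
  · rw [zero_add, mul_assoc]
    refine mul_le_mul_of_nonneg_left ?_ hn.le
    simp_rw [mul_add]
    rw [Finset.sum_add_distrib]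
    have hk := sqrt_key (Fintype.card X) (Fintype.card U) (by exact_mod_cast Fintype.card_pos)
      (by exact_mod_cast Fintype.card_pos)
    rw [← hG] at hk
    have h1 := mul_le_mul_of_nonneg_right hk hB0
    have h2 := mul_le_mul_of_nonneg_left ((add_le_add hx hu).trans (le_of_eq_of_le (add_mul _ _ _).symm h1)) m.hLR
    have : 0 ≤ m.MR * (G * B) := mul_nonneg m.hMR (mul_nonneg (Real.sqrt_nonneg _) hB0)
    unfold CR
    linarith

end deg

lemma main_all [Nonempty X] [Nonempty U] (hK : 0 < K) (hN : ∀ k, 0 < N k) (x0 : Cfg N X)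
    (t : ℕ) (k : Fin K) :
    |∑ s, m.ps x0 t s * ∑ j, m.r k (s.1 k j) (s.2 k j) (emp N s.1) (emp N s.2)
        - N k * m.rw' t (m.mus x0 t) k|
      ≤ N k * (m.CR * Real.sqrt ((Fintype.card X : ℝ) * Fintype.card U)
          * (∑ k, 1 / Real.sqrt (N k))
        + m.CP * (m.SR / (m.SP - 1)) * Real.sqrt ((Fintype.card X : ℝ) * Fintype.card U)
          * (∑ k, 1 / Real.sqrt (N k)) * (m.SP ^ t - 1)) := by
  rw [sum_ps]
  by_cases h : m.SP = 1
  · have hk : (1 : ℝ) ≤ K := by exact_mod_cast hK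
    have h1 := m.hLP
    have h2 := m.hLQ
    have h3 : 0 ≤ (K : ℝ) * m.LP * (K * m.LQ) := by positivity
    have h4 : m.LP ≤ K * m.LP := le_mul_of_one_le_left h1 hk
    have h5 : m.LQ ≤ K * m.LQ := le_mul_of_one_le_left h2 hk
    have h' := h
    unfold SP at h'
    have hP : m.LP = 0 := by nlinarith
    have hQ : m.LQ = 0 := by nlinarith
    refine (main_deg hN hP hQ x0 t k).trans (le_of_eq ?_)
    rw [h]; simp
  · exact main_gen hN x0 h t k

end Mdl

lemma part_sum {Ω S : Type*} [MeasurableSpace Ω] (P : Measure Ω) [IsProbabilityMeasure P]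
    [Fintype S] [DecidableEq S] (Z : Ω → S) (hZ : ∀ s, MeasurableSet {ω | Z ω = s})
    (A : Set Ω) (hA : MeasurableSet A) :
    P.real A = ∑ s, P.real (A ∩ {ω | Z ω = s}) := by
  rw [← measureReal_biUnion_finset]
  · congr 1
    ext ω
    simp
  · intro s _ s' _ hss
    refine Set.disjoint_left.2 ?_
    rintro ω ⟨_, h1⟩ ⟨_, h2⟩
    exact hss (h1.symm.trans h2)
  · intro s _
    exact hA.inter (hZ s)

lemma seg_meas {Ω S : Type*} [MeasurableSpace Ω] (Z : ℕ → Ω → S)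
    (hZ : ∀ t s, MeasurableSet {ω | Z t ω = s}) (a T : ℕ) (z : ℕ → S) :
    MeasurableSet {ω | ∀ t, a ≤ t → t ≤ T → Z t ω = z t} := by
  simp only [Set.ofPred_forall]
  exact MeasurableSet.iInter fun t => MeasurableSet.iInter fun _ => MeasurableSet.iInter fun _ =>
    hZ t (z t)

lemma seg_split {Ω S : Type*} [MeasurableSpace Ω] (P : Measure Ω) [IsProbabilityMeasure P]
    [Fintype S] [DecidableEq S] (Z : ℕ → Ω → S) (hZ : ∀ t s, MeasurableSet {ω | Z t ω = s})
    (a T : ℕ) (haT : a ≤ T) (z : ℕ → S) :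
    P.real {ω | ∀ t, a + 1 ≤ t → t ≤ T → Z t ω = z t}
      = ∑ s, P.real {ω | ∀ t, a ≤ t → t ≤ T → Z t ω = Function.update z a s t} := by
  rw [part_sum P (Z a) (hZ a) _ (seg_meas Z hZ (a + 1) T z)]
  refine Finset.sum_congr rfl fun s _ => ?_
  congr 1
  ext ω
  simp only [Set.mem_inter_iff, Set.mem_ofPred_eq]
  constructor
  · rintro ⟨h1, h2⟩ t hat htT
    rcases eq_or_lt_of_le hat with rfl | h
    · simpa using h2
    · rw [Function.update_of_ne (by omega)]
      exact h1 t h htT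
  · intro h
    refine ⟨fun t h1 h2 => ?_, ?_⟩
    · have := h t (by omega) h2
      rwa [Function.update_of_ne (by omega)] at this
    · simpa using h a le_rfl haT

lemma markov {Ω S : Type*} [MeasurableSpace Ω] (P : Measure Ω) [IsProbabilityMeasure P]
    [Fintype S] [DecidableEq S] (Z : ℕ → Ω → S) (hZ : ∀ t s, MeasurableSet {ω | Z t ω = s})
    (w0 : S → ℝ) (κ : ℕ → S → S → ℝ)
    (h : ∀ T (z : ℕ → S), P.real {ω | ∀ t ≤ T, Z t ω = z t}
      = w0 (z 0) * ∏ t ∈ Finset.range T, κ t (z t) (z (t + 1))) :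
    (∀ s, P.real {ω | Z 0 ω = s} = w0 s) ∧
    ∀ T s', P.real {ω | Z (T + 1) ω = s'} = ∑ s, P.real {ω | Z T ω = s} * κ T s s' := by
  refine ⟨fun s => ?_, ?_⟩
  · have := h 0 (fun _ => s)
    simpa using this
  have seg : ∀ a T (z : ℕ → S), a ≤ T →
      P.real {ω | ∀ t, a ≤ t → t ≤ T + 1 → Z t ω = z t}
        = P.real {ω | ∀ t, a ≤ t → t ≤ T → Z t ω = z t} * κ T (z T) (z (T + 1)) := by
    intro a
    induction a with
    | zero =>
      intro T z _
      have h1 := h (T + 1) z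
      have h2 := h T z
      simp only [zero_le, true_imp_iff]
      rw [h1, h2, Finset.prod_range_succ, mul_assoc]
    | succ a ih =>
      intro T z haT
      rw [seg_split P Z hZ a (T + 1) (by omega), seg_split P Z hZ a T (by omega), Finset.sum_mul]
      refine Finset.sum_congr rfl fun s _ => ?_
      rw [ih T _ (by omega), Function.update_of_ne (by omega), Function.update_of_ne (by omega)]
  intro T s'
  have e : ∀ b (s : S), {ω | Z b ω = s} = {ω | ∀ t, b ≤ t → t ≤ b → Z t ω = s} := by
    intro b s
    ext ω
    simp only [Set.mem_ofPred_eq]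
    exact ⟨fun h t h1 h2 => (le_antisymm h1 h2) ▸ h, fun h => h b le_rfl le_rfl⟩
  rw [e (T + 1) s']
  have := seg_split P Z hZ T (T + 1) (by omega) (fun _ => s')
  rw [this]
  refine Finset.sum_congr rfl fun s _ => ?_
  rw [seg T T _ le_rfl]
  congr 1
  · congr 1
    ext ω
    simp only [Set.mem_ofPred_eq]
    constructor
    · intro h
      simpa using h T le_rfl le_rfl
    · intro h t h1 h2
      have : t = T := le_antisymm h2 h1
      subst this
      simpa using h
  · simp

lemma integral_fin {Ω S : Type*} [MeasurableSpace Ω] (P : Measure Ω) [IsProbabilityMeasure P]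
    [Fintype S] [DecidableEq S] (Z : Ω → S) (hZ : ∀ s, MeasurableSet {ω | Z ω = s}) (F : S → ℝ) :
    Integrable (fun ω => F (Z ω)) P ∧ ∫ ω, F (Z ω) ∂P = ∑ s, P.real {ω | Z ω = s} * F s := by
  have e : (fun ω => F (Z ω)) = fun ω => ∑ s, ({ω | Z ω = s} : Set Ω).indicator (fun _ => F s) ω := by
    funext ω
    simp [Set.indicator_apply]
  have hi : ∀ s, Integrable (({ω | Z ω = s} : Set Ω).indicator (fun _ => F s)) P := fun s =>
    (integrable_const (F s)).indicator (hZ s)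
  rw [e]
  refine ⟨integrable_finsetSum _ fun s _ => hi s, ?_⟩
  rw [integral_finsetSum _ fun s _ => hi s]
  refine Finset.sum_congr rfl fun s _ => ?_
  rw [integral_indicator_const _ (hZ s), smul_eq_mul]

lemma law_eq {Ω : Type*} [MeasurableSpace Ω] (P : Measure Ω) [IsProbabilityMeasure P]
    {X U : Type*} [Fintype X] [Fintype U] [DecidableEq X] [DecidableEq U]
    {K : ℕ} {N : Fin K → ℕ} (hN : ∀ k, 0 < N k) (m : Mdl X U K) (x0 : Cfg N X)
    (Z : ℕ → Ω → Cfg N X × Cfg N U) (hZ : ∀ t s, MeasurableSet {ω | Z t ω = s})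
    (hx0 : ∀ ω, (Z 0 ω).1 = x0)
    (hlaw : ∀ (T : ℕ) (z : ℕ → Cfg N X × Cfg N U), (z 0).1 = x0 →
      P {ω | ∀ t ≤ T, Z t ω = z t} = ENNReal.ofReal
        ((∏ t ∈ Finset.range (T + 1), m.wU t (z t).1 (z t).2)
          * ∏ t ∈ Finset.range T, m.wX (z t).1 (z t).2 (z (t + 1)).1)) (t : ℕ)
    (s : Cfg N X × Cfg N U) : P.real {ω | Z t ω = s} = m.ps x0 t s := by
  obtain ⟨h0, h1⟩ := markov P Z hZ (fun s => m.ps x0 0 s)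
    (fun t s s' => m.wX s.1 s.2 s'.1 * m.wU (t + 1) s'.1 s'.2) (by
      intro T z
      by_cases hz : (z 0).1 = x0
      · rw [measureReal_def, hlaw T z hz, ENNReal.toReal_ofReal]
        · rw [Finset.prod_range_succ', Finset.prod_mul_distrib]
          simp only [Mdl.ps, Mdl.q, hz, if_true]
          ring
        · exact mul_nonneg (Finset.prod_nonneg fun t _ => (Mdl.wU_prob hN t _).1 _)
            (Finset.prod_nonneg fun t _ => (Mdl.wX_prob hN _ _).1 _)
      · have : {ω | ∀ t ≤ T, Z t ω = z t} = ∅ := by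
          ext ω
          simp only [Set.mem_ofPred_eq, Set.mem_empty_iff_false, iff_false]
          intro h
          apply hz
          rw [← h 0 (Nat.zero_le _), hx0]
        rw [this]
        simp [Mdl.ps, Mdl.q, hz])
  induction t generalizing s with
  | zero => exact h0 s
  | succ t ih =>
    rw [h1]
    simp_rw [ih]
    have := Mdl.sum_ps (m := m) x0 t (fun s' => m.wX s'.1 s'.2 s.1 * m.wU (t + 1) s.1 s.2)
    rw [this]
    simp only [Mdl.ps, Mdl.q, Finset.sum_mul, Finset.mul_sum]
    refine Finset.sum_congr rfl fun c _ => Finset.sum_congr rfl fun d _ => ?_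
    ring

theorem stmt10 {Ω : Type*} [MeasurableSpace Ω] (P : Measure Ω) [IsProbabilityMeasure P]
    {X U : Type*} [Fintype X] [Fintype U] [Nonempty X] [Nonempty U]
    [DecidableEq X] [DecidableEq U]
    [MeasurableSpace X] [MeasurableSingletonClass X]
    [MeasurableSpace U] [MeasurableSingletonClass U]
    (K : ℕ) (hK : 0 < K) (N : Fin K → ℕ) (hN : ∀ k, 0 < N k)
    (Npop : ℝ) (hNpop : Npop = ∑ k, (N k : ℝ))
    (γ : ℝ) (hγ0 : 0 ≤ γ) (hγ1 : γ < 1)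
    (MR LR LP LQ : ℝ) (hMR : 0 ≤ MR) (hLR : 0 ≤ LR) (hLP : 0 ≤ LP) (hLQ : 0 ≤ LQ)
    -- the reward functions (depending on classwise distributions)
    (r : Fin K → X → U → (X × Fin K → ℝ) → (U × Fin K → ℝ) → ℝ)
    (hrBdd : ∀ k x u μ ν, IsProbK μ → IsProbK ν → |r k x u μ ν| ≤ MR)
    (hrLip : ∀ k x u μ₁ ν₁ μ₂ ν₂, IsProbK μ₁ → IsProbK ν₁ → IsProbK μ₂ → IsProbK ν₂ →
      |r k x u μ₁ ν₁ - r k x u μ₂ ν₂| ≤ LR * (l1 μ₁ μ₂ + l1 ν₁ ν₂))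
    -- the transition kernels
    (Pk : Fin K → X → U → (X × Fin K → ℝ) → (U × Fin K → ℝ) → X → ℝ)
    (hPkProb : ∀ k x u μ ν, IsProbK μ → IsProbK ν → IsProb (Pk k x u μ ν))
    (hPkLip : ∀ k x u μ₁ ν₁ μ₂ ν₂, IsProbK μ₁ → IsProbK ν₁ → IsProbK μ₂ → IsProbK ν₂ →
      l1 (Pk k x u μ₁ ν₁) (Pk k x u μ₂ ν₂) ≤ LP * (l1 μ₁ μ₂ + l1 ν₁ ν₂))
    -- the policy
    (pi : ℕ → Fin K → X → (X × Fin K → ℝ) → U → ℝ)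
    (hpiProb : ∀ t k x μ, IsProbK μ → IsProb (pi t k x μ))
    (hpiLip : ∀ t k x μ₁ μ₂, IsProbK μ₁ → IsProbK μ₂ →
      l1 (pi t k x μ₁) (pi t k x μ₂) ≤ LQ * l1 μ₁ μ₂)
    -- classwise empirical state and action distributions of a configuration
    (empX : ((k : Fin K) → Fin (N k) → X) → X × Fin K → ℝ)
    (hempX : ∀ c x0 k, empX c (x0, k) = (∑ j, if c k j = x0 then (1 : ℝ) else 0) / (N k : ℝ))
    (empU : ((k : Fin K) → Fin (N k) → U) → U × Fin K → ℝ)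
    (hempU : ∀ c u0 k, empU c (u0, k) = (∑ j, if c k j = u0 then (1 : ℝ) else 0) / (N k : ℝ))
    -- the N-agent process
    (x0 : (k : Fin K) → Fin (N k) → X)
    (xpr : ℕ → (k : Fin K) → Fin (N k) → Ω → X)
    (upr : ℕ → (k : Fin K) → Fin (N k) → Ω → U)
    (hmeasx : ∀ t k j, Measurable (xpr t k j))
    (hmeasu : ∀ t k j, Measurable (upr t k j))
    (hx0 : ∀ k j ω, xpr 0 k j ω = x0 k j)
    (hlaw : ∀ (T : ℕ) (Xs : ℕ → (k : Fin K) → Fin (N k) → X)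
        (Us : ℕ → (k : Fin K) → Fin (N k) → U), (∀ k j, Xs 0 k j = x0 k j) →
      P {ω | ∀ t ≤ T, (∀ k j, xpr t k j ω = Xs t k j) ∧ ∀ k j, upr t k j ω = Us t k j}
        = ENNReal.ofReal
            ((∏ t ∈ Finset.range (T + 1), ∏ k, ∏ j,
                pi t k (Xs t k j) (empX (Xs t)) (Us t k j))
              * ∏ t ∈ Finset.range T, ∏ k, ∏ j,
                  Pk k (Xs t k j) (Us t k j) (empX (Xs t)) (empU (Us t)) (Xs (t + 1) k j)))
    -- the value of the policy in the N-agent system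
    (vN : ℝ)
    (hvN : vN = (1 / Npop) * ∑ k, ∑ j, ∫ ω, ∑' t : ℕ,
      γ ^ t * r k (xpr t k j ω) (upr t k j ω)
        (empX (fun k' j' => xpr t k' j' ω)) (empU (fun k' j' => upr t k' j' ω)) ∂P)
    -- the mean-field flow started from the classwise empirical distributions of
    -- the initial states
    (nuMF : ℕ → (X × Fin K → ℝ) → U × Fin K → ℝ)
    (hnuMF : ∀ t μ u0 k, nuMF t μ (u0, k) = ∑ x, pi t k x μ u0 * μ (x, k))
    (muSeq : ℕ → X × Fin K → ℝ)
    (hmu0 : muSeq 0 = empX x0)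
    (hmuStep : ∀ t x1 k, muSeq (t + 1) (x1, k) =
      ∑ x, ∑ u0, muSeq t (x, k) * pi t k x (muSeq t) u0 *
        Pk k x u0 (muSeq t) (nuMF t (muSeq t)) x1)
    (rMF : ℕ → Fin K → ℝ)
    (hrMF : ∀ t k, rMF t k = ∑ x, ∑ u0,
      muSeq t (x, k) * pi t k x (muSeq t) u0 * r k x u0 (muSeq t) (nuMF t (muSeq t)))
    -- the mean-field value, weighted by the class proportions θ k = N k / Npop
    (vMF : ℝ)
    (hvMF : vMF = ∑ k, ((N k : ℝ) / Npop) * ∑' t : ℕ, γ ^ t * rMF t k)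
    -- the constants
    (CR CP SR SP : ℝ)
    (hCR : CR = MR + LR) (hCP : CP = 2 + (K : ℝ) * LP)
    (hSR : SR = MR * (1 + LQ) + LR * (2 + (K : ℝ) * LQ))
    (hSP : SP = (1 + (K : ℝ) * LQ) + (K : ℝ) * LP * (2 + (K : ℝ) * LQ))
    (hγSP : γ * SP < 1) :
    |vN - vMF|
      ≤ CR / (1 - γ) * Real.sqrt ((Fintype.card X : ℝ) * Fintype.card U)
          * (∑ k, 1 / Real.sqrt (N k))
        + CP * (SR / (SP - 1)) * Real.sqrt ((Fintype.card X : ℝ) * Fintype.card U)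
          * (∑ k, 1 / Real.sqrt (N k))
          * (1 / (1 - γ * SP) - 1 / (1 - γ)) := by
  classical
  have hEX : empX = emp N := by
    funext c p
    exact hempX c p.1 p.2
  have hEU : empU = emp N := by
    funext c p
    exact hempU c p.1 p.2
  subst hEX hEU
  let m : Mdl X U K := ⟨MR, LR, LP, LQ, hMR, hLR, hLP, hLQ, r, hrBdd, hrLip, Pk, hPkProb, hPkLip,
    pi, hpiProb, hpiLip⟩
  have hnu : nuMF = m.nu := by
    funext t μ p
    rw [show p = (p.1, p.2) from rfl, hnuMF]
    exact Finset.sum_congr rfl fun x _ => mul_comm _ _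
  subst hnu
  have hmu : ∀ t, muSeq t = m.mus x0 t := by
    intro t
    induction t with
    | zero => exact hmu0
    | succ t ih =>
      funext p
      rw [show p = (p.1, p.2) from rfl, hmuStep, ih]
      simp only [Mdl.mus, Mdl.nxt]
      rw [Fintype.sum_prod_type]
      rfl
  have hr : ∀ t k, rMF t k = m.rw' t (m.mus x0 t) k := by
    intro t k
    rw [hrMF, hmu, Mdl.rw', Fintype.sum_prod_type]
    rfl
  let Z : ℕ → Ω → Cfg N X × Cfg N U := fun t ω => (fun k j => xpr t k j ω, fun k j => upr t k j ω)
  have hZeq : ∀ t s, {ω | Z t ω = s}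
      = {ω | (∀ k j, xpr t k j ω = s.1 k j) ∧ ∀ k j, upr t k j ω = s.2 k j} := by
    intro t s
    ext ω
    simp only [Set.mem_ofPred_eq, Z, Prod.ext_iff, funext_iff]
  have hZ : ∀ t s, MeasurableSet {ω | Z t ω = s} := by
    intro t s
    have h1 : MeasurableSet {ω | ∀ k j, xpr t k j ω = s.1 k j} := by
      simp only [Set.ofPred_forall]
      exact MeasurableSet.iInter fun k => MeasurableSet.iInter fun j =>
        hmeasx t k j (measurableSet_singleton _)
    have h2 : MeasurableSet {ω | ∀ k j, upr t k j ω = s.2 k j} := by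
      simp only [Set.ofPred_forall]
      exact MeasurableSet.iInter fun k => MeasurableSet.iInter fun j =>
        hmeasu t k j (measurableSet_singleton _)
    rw [hZeq]
    exact h1.inter h2
  have hps : ∀ t s, P.real {ω | Z t ω = s} = m.ps x0 t s := by
    intro t s
    refine law_eq P hN m x0 Z hZ (fun ω => ?_) (fun T z hz => ?_) t s
    · funext k j
      exact hx0 k j ω
    · have := hlaw T (fun t => (z t).1) (fun t => (z t).2) (fun k j => by rw [hz])
      rw [show {ω | ∀ t ≤ T, Z t ω = z t} = {ω | ∀ t ≤ T, (∀ k j, xpr t k j ω = (z t).1 k j) ∧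
        ∀ k j, upr t k j ω = (z t).2 k j} from ?_]
      · exact this
      · ext ω
        simp only [Set.mem_ofPred_eq, Z, Prod.ext_iff, funext_iff]
  have hNpos : 0 < Npop := by
    rw [hNpop]
    exact Finset.sum_pos (fun k _ => Nat.cast_pos.2 (hN k)) ⟨⟨0, hK⟩, Finset.mem_univ _⟩
  have hmp := fun t => Mdl.mus_prob (m := m) hN x0 t
  have hgeo := summable_geometric_of_lt_one hγ0 hγ1
  -- the value as a sum
  have hA : ∀ k (j : Fin (N k)), HasSum
      (fun t : ℕ => γ ^ t * ∑ s, m.ps x0 t s * r k (s.1 k j) (s.2 k j) (emp N s.1) (emp N s.2))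
      (∫ ω, ∑' t : ℕ, γ ^ t * r k (xpr t k j ω) (upr t k j ω)
        (emp N (fun k' j' => xpr t k' j' ω)) (emp N (fun k' j' => upr t k' j' ω)) ∂P) := by
    intro k j
    let F : ℕ → Cfg N X × Cfg N U → ℝ := fun t s =>
      γ ^ t * r k (s.1 k j) (s.2 k j) (emp N s.1) (emp N s.2)
    have hF : ∀ t s, ‖F t s‖ ≤ γ ^ t * MR := by
      intro t s
      simp only [F]
      rw [norm_mul, Real.norm_of_nonneg (pow_nonneg hγ0 t)]
      exact mul_le_mul_of_nonneg_left
        (hrBdd _ _ _ _ _ (emp_isProbK hN s.1) (emp_isProbK hN s.2)) (pow_nonneg hγ0 t)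
    have hi := fun t => integral_fin P (Z t) (hZ t) (F t)
    have hs : Summable fun t => ∫ ω, ‖F t (Z t ω)‖ ∂P := by
      refine Summable.of_nonneg_of_le (fun t => integral_nonneg fun ω => norm_nonneg _)
        (fun t => ?_) (hgeo.mul_right MR)
      calc _ ≤ ∫ ω, γ ^ t * MR ∂P :=
            integral_mono (hi t).1.norm (integrable_const _) fun ω => hF t _
        _ = _ := by simp
    have := hasSum_integral_of_summable_integral_norm (fun t => (hi t).1) hs
    refine Eq.mp ?_ this
    congr 1
    funext t
    rw [(hi t).2, Finset.mul_sum]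
    refine Finset.sum_congr rfl fun s _ => ?_
    rw [hps]
    simp only [F]; ring
  have hB : ∀ k, HasSum (fun t : ℕ => γ ^ t * rMF t k) (∑' t : ℕ, γ ^ t * rMF t k) := by
    intro k
    apply Summable.hasSum
    refine Summable.of_norm_bounded (hgeo.mul_right MR) fun t => ?_
    rw [norm_mul, Real.norm_of_nonneg (pow_nonneg hγ0 t), hr]
    exact mul_le_mul_of_nonneg_left (Mdl.rw_bdd (m := m) (hmp t) k) (pow_nonneg hγ0 t)
  have hV1 := (hasSum_sum fun k (_ : k ∈ Finset.univ) =>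
    hasSum_sum fun j (_ : j ∈ Finset.univ) => hA k j).mul_left (1 / Npop)
  rw [← hvN] at hV1
  have hV2 := hasSum_sum fun k (_ : k ∈ Finset.univ) => (hB k).mul_left ((N k : ℝ) / Npop)
  rw [← hvMF] at hV2
  have hV := hV1.sub hV2
  have hSPm : m.SP = SP := hSP.symm
  have hSRm : m.SR = SR := hSR.symm
  have hCPm : m.CP = CP := hCP.symm
  have hCRm : m.CR = CR := hCR.symm
  have hSP1 : 0 ≤ SP := by rw [hSP]; positivity
  set B := ∑ k, 1 / Real.sqrt (N k) with hBdef
  set G := Real.sqrt ((Fintype.card X : ℝ) * Fintype.card U) with hGdef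
  have g1 := hasSum_geometric_of_lt_one hγ0 hγ1
  have g2 := hasSum_geometric_of_lt_one (mul_nonneg hγ0 hSP1) hγSP
  have hG := (g1.mul_left (CR * G * B)).add ((g2.sub g1).mul_left (CP * (SR / (SP - 1)) * G * B))
  have hfin := hV.norm_le_of_bounded hG (by
    intro t
    have hm := fun k => Mdl.main_all (m := m) hK hN x0 t k
    simp only [hSPm, hSRm, hCPm, hCRm, ← hBdef, ← hGdef] at hm
    set e := CR * G * B + CP * (SR / (SP - 1)) * G * B * (SP ^ t - 1) with he
    have e1 : 1 / Npop * ∑ k, ∑ j : Fin (N k), γ ^ t *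
          ∑ s, m.ps x0 t s * r k (s.1 k j) (s.2 k j) (emp N s.1) (emp N s.2)
        - ∑ k, (N k : ℝ) / Npop * (γ ^ t * rMF t k)
        = γ ^ t / Npop * ∑ k,
          (∑ s, m.ps x0 t s * ∑ j, m.r k (s.1 k j) (s.2 k j) (emp N s.1) (emp N s.2)
            - N k * m.rw' t (m.mus x0 t) k) := by
      rw [Finset.mul_sum, ← Finset.sum_sub_distrib, Finset.mul_sum]
      refine Finset.sum_congr rfl fun k _ => ?_
      have e2 : ∑ s : Cfg N X × Cfg N U, m.ps x0 t s *
            ∑ j, m.r k (s.1 k j) (s.2 k j) (emp N s.1) (emp N s.2)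
          = ∑ j : Fin (N k), ∑ s : Cfg N X × Cfg N U, m.ps x0 t s *
            r k (s.1 k j) (s.2 k j) (emp N s.1) (emp N s.2) := by
        simp_rw [Finset.mul_sum]
        exact Finset.sum_comm (s := Finset.univ) (t := (Finset.univ : Finset (Fin (N k))))
          (f := fun (s : Cfg N X × Cfg N U) j => m.ps x0 t s *
            r k (s.1 k j) (s.2 k j) (emp N s.1) (emp N s.2))
      rw [e2, ← Finset.mul_sum, hr]
      ring
    rw [e1, norm_mul, Real.norm_of_nonneg (div_nonneg (pow_nonneg hγ0 t) hNpos.le), Real.norm_eq_abs]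
    calc _ ≤ γ ^ t / Npop * ∑ k, (N k : ℝ) * e := by
          refine mul_le_mul_of_nonneg_left ?_ (div_nonneg (pow_nonneg hγ0 t) hNpos.le)
          exact (Finset.abs_sum_le_sum_abs _ _).trans (Finset.sum_le_sum fun k _ => hm k)
      _ = γ ^ t * e := by
          rw [← Finset.sum_mul, ← hNpop]
          field_simp
      _ ≤ _ := le_of_eq (by rw [he, mul_pow]; ring))
  rw [Real.norm_eq_abs] at hfin
  refine hfin.trans (le_of_eq ?_)
  simp only [one_div]
  ring
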